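/- Let M = M_1 *_B M_2 be an amalgamated free product of σ-finite von Neumann algebras. There exists a (nonunital) normal *-homomorphism π : ⟨M_1, B⟩ → B(L²(M)) whose range is contained in the Jones basic construction ⟨M, M_1⟩, such that π(e_B) = P_K and π(x) = x·e_{M_1}^⊥ for every x ∈ M_1 ⊆ M, where e_B ∈ ⟨M_1, B⟩ is the Jones projection of B ⊆ M_1 and e_{M_1} : L²(M) → L²(M_1) is the Jones projection of M_1 ⊆ M. -/

import Mathlib

/- Framework: von Neumann algebras are modeled concretely as `VonNeumannAlgebra H` for a
complex Hilbert space `H` (in the relevant statements, `H` plays the role of the standard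
form Hilbert space `L²(M)`).  Conditional expectations, normality (complete additivity,
phrased via preservation of suprema of upward-directed sets in the Loewner order),
faithfulness, σ-finiteness, standard forms, Jones basic constructions `⟨M, Q⟩ = (JQJ)'`,
amalgamated free products, Popa's intertwining relation `A ≼_M B` and relative amenability
are all defined below. -/

open scoped InnerProductSpace ComplexOrder

noncomputable section

namespace AFP

variable {H : Type*} [NormedAddCommGroup H] [InnerProductSpace ℂ H] [CompleteSpace H]

abbrev BH (H : Type*) [NormedAddCommGroup H] [InnerProductSpace ℂ H] [CompleteSpace H] :=
  H →L[ℂ] H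

/-- A (self-adjoint) projection in `B(H)`. -/
def IsProjection (p : BH H) : Prop := IsSelfAdjoint p ∧ IsIdempotentElem p

/-- A map defined (at least) on `N ⊆ B(H)` is *normal* on `N` if it preserves suprema of
upward-directed subsets of `N` (with respect to the Loewner order on `B(H)`). -/
def IsNormalOn (N : Set (BH H)) (Φ : BH H → BH H) : Prop :=
  ∀ S : Set (BH H), S ⊆ N → S.Nonempty → DirectedOn (· ≤ ·) S →
    ∀ x ∈ N, IsLUB S x → IsLUB (Φ '' S) (Φ x)

/-- A complex-valued functional is normal on `N` if it preserves suprema of upward-directed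
subsets of `N` (using the standard partial order on `ℂ`). -/
def IsNormalFunctionalOn (N : Set (BH H)) (φ : BH H → ℂ) : Prop :=
  ∀ S : Set (BH H), S ⊆ N → S.Nonempty → DirectedOn (· ≤ ·) S →
    ∀ x ∈ N, IsLUB S x → IsLUB (φ '' S) (φ x)

/-- A map is faithful on `N` if it kills no nonzero positive element of `N`. -/
def FaithfulOn (N : Set (BH H)) (Φ : BH H → BH H) : Prop :=
  ∀ x ∈ N, 0 ≤ x → Φ x = 0 → x = 0

/-- A conditional expectation from `N` onto `P ⊆ N` (as subsets of `B(H)`):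
a unital positive `P`-bimodular projection of `N` onto `P`. -/
structure IsCondExp (N P : Set (BH H)) (Φ : BH H → BH H) : Prop where
  subset : P ⊆ N
  map_add : ∀ x ∈ N, ∀ y ∈ N, Φ (x + y) = Φ x + Φ y
  map_smul : ∀ (c : ℂ), ∀ x ∈ N, Φ (c • x) = c • Φ x
  maps_to : ∀ x ∈ N, Φ x ∈ P
  fixes : ∀ x ∈ P, Φ x = x
  pos : ∀ x ∈ N, 0 ≤ x → 0 ≤ Φ x
  bimod : ∀ a ∈ P, ∀ b ∈ P, ∀ x ∈ N, Φ (a * x * b) = a * Φ x * b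

/-- The inclusion `P ⊆ N` is *with expectation*: there is a faithful normal conditional
expectation of `N` onto `P`. -/
def WithExpectation (N P : Set (BH H)) : Prop :=
  ∃ Φ : BH H → BH H, IsCondExp N P Φ ∧ FaithfulOn N Φ ∧ IsNormalOn N Φ

/-- σ-finiteness (countable decomposability) of a von Neumann algebra viewed as a subset
of `B(H)`: any family of pairwise orthogonal nonzero projections in it is countable. -/
def SigmaFinite (N : Set (BH H)) : Prop :=
  ∀ F : Set (BH H), F ⊆ N → (∀ p ∈ F, IsProjection p ∧ p ≠ 0) →
    (∀ p ∈ F, ∀ q ∈ F, p ≠ q → p * q = 0) → F.Countable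

/-- Conjugation `T ↦ J T J` of a bounded operator by a conjugate-linear isometric involution. -/
def conjJ (J : H ≃ₗᵢ⋆[ℂ] H) (T : BH H) : BH H where
  toFun := fun ξ => J (T (J.symm ξ))
  map_add' := by intro ξ η; simp
  map_smul' := by intro c ξ; simp [map_smulₛₗ]
  cont := J.continuous.comp (T.continuous.comp J.symm.continuous)

/-- Standard form data for a von Neumann algebra `M ⊆ B(H)`: the modular conjugation `J`
and the self-dual positive cone `L²(M)₊`, with their basic properties. -/
structure StandardForm (M : VonNeumannAlgebra H) where
  J : H ≃ₗᵢ⋆[ℂ] H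
  cone : Set H
  J_involutive : ∀ ξ, J (J ξ) = ξ
  J_fixes_cone : ∀ ξ ∈ cone, J ξ = ξ
  commutant_eq : Set.centralizer (M : Set (BH H)) = conjJ J '' (M : Set (BH H))
  selfdual : cone = {ξ : H | ∀ η ∈ cone, 0 ≤ ⟪ξ, η⟫_ℂ}
  cone_invariant : ∀ x ∈ (M : Set (BH H)), ∀ ξ ∈ cone, x (conjJ J x ξ) ∈ cone

/-- The Jones basic construction `⟨M, Q⟩ = (JQJ)'` associated with a subalgebra `Q ⊆ M`,
where `J` is the modular conjugation of `M` in its standard form `H = L²(M)`. -/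
def basicConstruction (J : H ≃ₗᵢ⋆[ℂ] H) (Q : Set (BH H)) : Set (BH H) :=
  Set.centralizer (conjJ J '' Q)

/-- The corner `e N e` of a subset `N ⊆ B(H)` by a projection `e`. -/
def Corner (e : BH H) (N : Set (BH H)) : Set (BH H) := {x | x ∈ N ∧ e * x * e = x}

/-- Popa's intertwining relation `A ≼_N C`: `A` embeds with expectation into `C` inside `N`.
There are projections `e ∈ A`, `f ∈ C`, a nonzero partial isometry `v ∈ eNf` and a unital
normal *-homomorphism `θ : eAe → fCf` such that `θ(eAe) ⊆ fCf` is with expectation and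
`a v = v θ(a)` for all `a ∈ eAe`. -/
def EmbedsWE (N A C : Set (BH H)) : Prop :=
  ∃ (e f v : BH H) (θ : BH H → BH H),
    e ∈ A ∧ IsProjection e ∧
    f ∈ C ∧ IsProjection f ∧
    v ∈ N ∧ v ≠ 0 ∧ v * star v * v = v ∧ e * v = v ∧ v * f = v ∧
    (∀ x ∈ Corner e A, θ x ∈ Corner f C) ∧
    (∀ x ∈ Corner e A, ∀ y ∈ Corner e A, θ (x + y) = θ x + θ y) ∧
    (∀ (c : ℂ), ∀ x ∈ Corner e A, θ (c • x) = c • θ x) ∧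
    (∀ x ∈ Corner e A, ∀ y ∈ Corner e A, θ (x * y) = θ x * θ y) ∧
    (∀ x ∈ Corner e A, θ (star x) = star (θ x)) ∧
    θ e = f ∧
    IsNormalOn (Corner e A) θ ∧
    WithExpectation (Corner f C) (θ '' Corner e A) ∧
    (∀ a ∈ Corner e A, a * v = v * θ a)

/-- Amalgamated free product structure `M = M₁ *_B M₂`: `M` is generated by `M₁` and `M₂`,
which both contain `B`, and `E : M → B` is a faithful normal conditional expectation with
respect to which `M₁` and `M₂` are freely independent with amalgamation over `B`
(`E` kills every reduced word with letters alternating between `ker E ∩ M₁` and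
`ker E ∩ M₂`; `E` restricts to the given expectations `Eᵢ : Mᵢ → B`). -/
structure IsAFP (M M₁ M₂ B : VonNeumannAlgebra H) (E : BH H → BH H) : Prop where
  le₁ : (B : Set (BH H)) ⊆ (M₁ : Set (BH H))
  le₂ : (B : Set (BH H)) ⊆ (M₂ : Set (BH H))
  le₁M : (M₁ : Set (BH H)) ⊆ (M : Set (BH H))
  le₂M : (M₂ : Set (BH H)) ⊆ (M : Set (BH H))
  generated : Set.centralizer (Set.centralizer ((M₁ : Set (BH H)) ∪ (M₂ : Set (BH H)))) = M
  condExp : IsCondExp (M : Set (BH H)) (B : Set (BH H)) E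
  faithful : FaithfulOn (M : Set (BH H)) E
  normal : IsNormalOn (M : Set (BH H)) E
  free : ∀ (n : ℕ) (x : Fin n → BH H) (ι : Fin n → Bool), 0 < n →
    (∀ k, x k ∈ (if ι k then (M₁ : Set (BH H)) else (M₂ : Set (BH H))) ∧ E (x k) = 0) →
    (∀ (k : ℕ) (h : k + 1 < n), ι ⟨k, Nat.lt_of_succ_lt h⟩ ≠ ι ⟨k + 1, h⟩) →
    E (List.ofFn x).prod = 0

/-- `P` is amenable relative to `Q` inside `M` (all sitting in `B(L²(M))`, `J` being the
modular conjugation of `M`): there is a conditional expectation `Φ : ⟨M, Q⟩ → P` whose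
restriction to `M` is faithful and normal. -/
def AmenableRel (J : H ≃ₗᵢ⋆[ℂ] H) (Mset P Q : Set (BH H)) : Prop :=
  ∃ Φ : BH H → BH H, IsCondExp (basicConstruction J Q) P Φ ∧
    FaithfulOn Mset Φ ∧ IsNormalOn Mset Φ

/-- Amenability (injectivity) of a von Neumann algebra `P ⊆ B(H)`: there is a conditional
expectation from all of `B(H)` onto `P`. -/
def IsAmenableVN (P : Set (BH H)) : Prop :=
  ∃ Φ : BH H → BH H, IsCondExp (Set.univ) P Φ

/-- The set of reduced words `x₁ ⋯ xₙ` in `M = M₁ *_B M₂` (letters alternating between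
`ker E ∩ M₁` and `ker E ∩ M₂`) starting with a letter `x₁ ∈ M₂ ⊖ B = ker E ∩ M₂`. -/
def ReducedWordsStartM₂ (M₁ M₂ : VonNeumannAlgebra H) (E : BH H → BH H) : Set (BH H) :=
  {w | ∃ (n : ℕ) (x : Fin n → BH H) (ι : Fin n → Bool) (hn : 0 < n),
    (∀ k, x k ∈ (if ι k then (M₁ : Set (BH H)) else (M₂ : Set (BH H))) ∧ E (x k) = 0) ∧
    (∀ (k : ℕ) (h : k + 1 < n), ι ⟨k, Nat.lt_of_succ_lt h⟩ ≠ ι ⟨k + 1, h⟩) ∧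
    ι ⟨0, hn⟩ = false ∧ w = (List.ofFn x).prod}

/-- The basic construction `⟨M₁, B⟩ = (J₁ B J₁)' ⊆ B(L²(M₁))`, realized as operators on
`L²(M)` supported on the subspace `L²(M₁)` (with orthogonal projection `P₁`): those `T`
with `P₁ T P₁ = T` commuting with each `J b J` (`b ∈ B`) on the range of `P₁`.  (Here the
modular conjugation of `M₁` is the restriction of `J` to `L²(M₁)`, which holds since there
is a state-preserving conditional expectation onto `M₁`.) -/
def relBasicConstruction (J : H ≃ₗᵢ⋆[ℂ] H) (Bset : Set (BH H)) (P₁ : BH H) :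
    Set (BH H) :=
  {T | P₁ * T * P₁ = T ∧
    ∀ b ∈ Bset, P₁ * (T * conjJ J b) * P₁ = P₁ * (conjJ J b * T) * P₁}

lemma aux_real_proj (K : Submodule ℝ H) (hK : IsClosed (K : Set H)) :
    ∃ P : H →L[ℝ] H, (∀ ζ, P ζ ∈ K) ∧ ∀ ζ, ∀ h ∈ K, (⟪ζ - P ζ, h⟫_ℂ).re = 0 := by
  let : InnerProductSpace ℝ H := InnerProductSpace.complexToReal
  have : CompleteSpace K := hK.completeSpace_coe
  refine ⟨K.starProjection, fun ζ => K.starProjection_apply_mem ζ, fun ζ h hh => ?_⟩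
  exact K.starProjection_inner_eq_zero ζ h hh

lemma aux_commute_sqrt {a b : BH H} (h : Commute a b) : Commute (CFC.sqrt a) b := by
  rw [CFC.sqrt_eq_cfc]
  exact h.cfc_nnreal _

lemma aux_adj (T : BH H) (x y : H) : ⟪(star T) x, y⟫_ℂ = ⟪x, T y⟫_ℂ :=
  ContinuousLinearMap.adjoint_inner_left T y x

lemma aux_adj' (T : BH H) (x y : H) : ⟪x, (star T) y⟫_ℂ = ⟪T x, y⟫_ℂ :=
  ContinuousLinearMap.adjoint_inner_right T x y

lemma aux_sa {T : BH H} (h : IsSelfAdjoint T) (x y : H) : ⟪T x, y⟫_ℂ = ⟪x, T y⟫_ℂ := by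
  rw [← aux_adj, h.star_eq]

/-- positive operators: square root facts -/
lemma aux_sqrt {c : BH H} (hc : 0 ≤ c) : ∃ r : BH H, IsSelfAdjoint r ∧ r * r = c ∧
    ∀ b, Commute c b → Commute r b := by
  refine ⟨CFC.sqrt c, (CFC.sqrt_nonneg c).isSelfAdjoint, CFC.sqrt_mul_sqrt_self c hc, fun b hb => aux_commute_sqrt hb⟩

lemma aux_nonneg_iff (T : BH H) : 0 ≤ T ↔ ∀ x, 0 ≤ ⟪x, T x⟫_ℂ := by
  rw [ContinuousLinearMap.nonneg_iff_isPositive]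
  constructor
  · intro h x; exact h.inner_nonneg_right x
  · intro h
    rw [ContinuousLinearMap.isPositive_iff_complex]
    intro x
    have := h x
    rw [← inner_conj_symm, Complex.le_def] at this
    simp only [Complex.zero_re, Complex.conj_re, Complex.zero_im, Complex.conj_im] at this
    refine ⟨?_, by simpa using this.1⟩
    apply Complex.ext <;> simp
    linarith [this.2]

/-- extension lemma -/
lemma aux_extend {X : Type*} [AddCommGroup X] [Module ℂ X] (e f : X →ₗ[ℂ] H) (C : ℝ)
    (h : ∀ x, ‖f x‖ ≤ C * ‖e x‖) :
    ∃ A : BH H, (∀ x, A (e x) = f x) ∧ ∀ v, (∀ x, ⟪e x, v⟫_ℂ = 0) → A v = 0 := by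
  set L : Submodule ℂ H := (LinearMap.range e).topologicalClosure with hL
  have : CompleteSpace L := (Submodule.isClosed_topologicalClosure _).completeSpace_coe
  have hmem : ∀ x, e x ∈ L := fun x => Submodule.le_topologicalClosure _ (LinearMap.mem_range_self e x)
  let e' : X →ₗ[ℂ] L := e.codRestrict L hmem
  have hd : DenseRange e' := by
    intro y
    rw [closure_subtype]
    have : (y : H) ∈ closure ((LinearMap.range e : Submodule ℂ H) : Set H) := y.2
    convert this using 2
    ext z
    simp only [Set.mem_image, Set.mem_range, SetLike.mem_coe, LinearMap.mem_range]
    constructor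
    · rintro ⟨w, ⟨x, rfl⟩, rfl⟩; exact ⟨x, rfl⟩
    · rintro ⟨x, rfl⟩; exact ⟨e' x, ⟨x, rfl⟩, rfl⟩
  refine ⟨(f.extendOfNorm e').comp L.orthogonalProjectionOnto, fun x => ?_, fun v hv => ?_⟩
  · have : L.orthogonalProjectionOnto (e x) = e' x :=
      Submodule.orthogonalProjectionOnto_mem_subspace_eq_self (e' x)
    rw [ContinuousLinearMap.comp_apply, this]
    exact LinearMap.extendOfNorm_eq hd ⟨C, h⟩ x
  · have : L.orthogonalProjectionOnto v = 0 := by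
      rw [Submodule.orthogonalProjectionOnto_eq_zero_iff, hL,
        Submodule.orthogonal_closure, Submodule.mem_orthogonal]
      rintro _ ⟨x, rfl⟩
      exact hv x
    rw [ContinuousLinearMap.comp_apply, this, map_zero]

lemma aux_antiinner (J : H ≃ₗᵢ⋆[ℂ] H) (x y : H) : ⟪J x, J y⟫_ℂ = ⟪y, x⟫_ℂ := by
  have hre : ∀ x y : H, (⟪J x, J y⟫_ℂ).re = (⟪y, x⟫_ℂ).re := by
    intro x y
    have h1 := norm_add_sq (𝕜 := ℂ) (J x) (J y)
    have h2 := norm_add_sq (𝕜 := ℂ) y x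
    rw [← map_add, J.norm_map, J.norm_map, J.norm_map, add_comm x y] at h1
    simp only [RCLike.re_eq_complex_re] at h1 h2
    linarith
  apply Complex.ext (hre x y)
  have := hre x (Complex.I • y)
  simp [inner_smul_left, inner_smul_right, map_smulₛₗ] at this
  linarith

/-- Real-subspace version of Tomita's polar decomposition argument. -/
lemma aux_J_comm (J : H ≃ₗᵢ⋆[ℂ] H) (hJ : ∀ ζ, J (J ζ) = ζ) (K : Submodule ℝ H)
    (hK : IsClosed (K : Set H))
    (ha : ∀ h ∈ K, Complex.I • h ∈ K → h = 0)
    (hb : ∀ ζ, (∀ h ∈ K, ⟪ζ, h⟫_ℂ = 0) → ζ = 0)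
    (hc1 : ∀ h ∈ K, ∀ k ∈ K, (⟪Complex.I • J h, k⟫_ℂ).re = 0)
    (hc2 : ∀ ζ, (∀ h ∈ K, (⟪ζ, h⟫_ℂ).re = 0) → Complex.I • J ζ ∈ K)
    (hd : ∀ h ∈ K, ∀ k ∈ K, 0 ≤ ⟪J (h + Complex.I • k), h - Complex.I • k⟫_ℂ)
    (e : BH H) (he : IsSelfAdjoint e) (heK : ∀ h ∈ K, e h ∈ K) (ζ : H) :
    e (J ζ) = J (e ζ) := by
  obtain ⟨P, hPK, hP⟩ := aux_real_proj K hK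
  have hII : ∀ v : H, Complex.I • Complex.I • v = -v := fun v => by
    rw [smul_smul, Complex.I_mul_I, neg_one_smul]
  have hJI : ∀ v : H, J (Complex.I • v) = -(Complex.I • J v) := fun v => by
    simp [map_smulₛₗ]
  -- uniqueness of the projection
  have huniq : ∀ v w, w ∈ K → (∀ h ∈ K, (⟪v - w, h⟫_ℂ).re = 0) → P v = w := by
    intro v w hw hvw
    have h1 : P v - w ∈ K := K.sub_mem (hPK v) hw
    have h2 : (⟪P v - w, P v - w⟫_ℂ).re = 0 := by
      have e1 := hvw _ h1
      have e2 := hP v _ h1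
      have : P v - w = (v - w) - (v - P v) := by abel
      conv_lhs => rw [this, inner_sub_left]
      rw [← this]
      simp [e1, e2]
    have h3 : P v - w = 0 := by
      have := inner_self_eq_norm_sq (𝕜 := ℂ) (P v - w)
      simp only [RCLike.re_eq_complex_re] at this
      rw [h2] at this
      exact norm_eq_zero.1 (pow_eq_zero_iff (two_ne_zero) |>.1 this.symm)
    exact sub_eq_zero.1 h3
  -- real symmetry of P
  have hPre : ∀ v w, (⟪P v, w⟫_ℂ).re = (⟪P v, P w⟫_ℂ).re := by
    intro v w
    have := hP w _ (hPK v)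
    rw [inner_sub_left, Complex.sub_re, sub_eq_zero] at this
    rw [← inner_conj_symm, Complex.conj_re, this, ← inner_conj_symm, Complex.conj_re]
  have hPsym : ∀ v w, (⟪P v, w⟫_ℂ).re = (⟪v, P w⟫_ℂ).re := by
    intro v w
    rw [hPre, ← inner_conj_symm v, Complex.conj_re, hPre w v, ← inner_conj_symm, Complex.conj_re]
  have hIre : ∀ v w : H, (⟪Complex.I • v, w⟫_ℂ).re = -(⟪v, Complex.I • w⟫_ℂ).re := by
    intro v w; simp [inner_smul_left, inner_smul_right]
  -- e commutes with P
  have heP : ∀ v, P (e v) = e (P v) := by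
    intro v
    apply huniq _ _ (heK _ (hPK v))
    intro h hh
    rw [← map_sub, aux_sa he]
    exact hP v _ (heK h hh)
  -- theta relation
  have hθ : ∀ v, P (Complex.I • J v) = Complex.I • J v - Complex.I • J (P v) := by
    intro v
    apply huniq
    · rw [← smul_sub, ← map_sub]
      exact hc2 _ (hP v)
    · intro h hh
      rw [sub_sub_cancel]
      exact hc1 _ (hPK v) _ hh
  have hPJ : ∀ v, P (J v) = J v - Complex.I • J (P (Complex.I • v)) := by
    intro v
    have := hθ (Complex.I • v)
    rw [hJI, smul_neg, hII, neg_neg] at this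
    exact this
  let A : H → H := fun v => P v + Complex.I • P (Complex.I • v)
  have hAdef : ∀ v, A v = P v + Complex.I • P (Complex.I • v) := fun v => rfl
  have hAI : ∀ v, A (Complex.I • v) = -(Complex.I • A v) := by
    intro v
    simp only [hAdef, hII, map_neg, smul_add, smul_neg]; abel
  have hAJ : ∀ v, A (J v) = J (A v) := by
    intro v
    simp only [hAdef, hPJ, hθ, map_add, hJI, smul_sub, hII]; abel
  have hAcont : Continuous A := by
    simp only [A]; fun_prop
  have hAadd : ∀ v w, A (v + w) = A v + A w := by
    intro v w; simp only [hAdef, map_add, smul_add]; abel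
  have hAr : ∀ (r : ℝ) v, A (r • v) = r • A v := by
    intro r v; simp only [hAdef, map_smul, smul_add, smul_comm Complex.I r]
  have hAsym : ∀ v w, (⟪A v, w⟫_ℂ).re = (⟪v, A w⟫_ℂ).re := by
    intro v w
    simp only [hAdef, inner_add_left, inner_add_right, Complex.add_re, hPsym v w, hIre]
    rw [hPsym, hIre, neg_neg]
  have hDz : ∀ (c : ℂ) v, J (A (c • v)) = c • J (A v) := by
    intro c v
    have h1 : c • v = c.re • v + c.im • Complex.I • v := by
      conv_lhs => rw [← Complex.re_add_im c]
      rw [add_smul, mul_smul]; rfl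
    have h2 : ∀ w : H, c • w = c.re • w + c.im • Complex.I • w := by
      intro w
      conv_lhs => rw [← Complex.re_add_im c]
      rw [add_smul, mul_smul]; rfl
    have hJr : ∀ (r : ℝ) (w : H), J (r • w) = r • J w := by
      intro r w
      have : r • w = (r : ℂ) • w := rfl
      rw [this, map_smulₛₗ]; simp
    rw [h2 (J _), h1, hAadd, hAr, hAr, hAI, map_add, hJr, hJr, map_neg, hJI, neg_neg]
  let D : BH H :=
    { toFun := fun v => J (A v)
      map_add' := fun v w => by rw [hAadd, map_add]
      map_smul' := fun c v => by simpa using hDz c v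
      cont := J.continuous.comp hAcont }
  have hDdef : ∀ v, D v = J (A v) := fun v => rfl
  let R : BH H :=
    { toFun := fun v => P v - Complex.I • P (Complex.I • v)
      map_add' := fun v w => by simp only [map_add, smul_add]; abel
      map_smul' := fun c v => by
        have hr : ∀ (r : ℝ) v, P (r • v) - Complex.I • P (Complex.I • r • v)
            = r • (P v - Complex.I • P (Complex.I • v)) := by
          intro r v
          rw [smul_comm Complex.I r v]
          simp only [map_smul, smul_sub, smul_comm Complex.I r]
        have h2 : ∀ w : H, c • w = c.re • w + c.im • Complex.I • w := by
          intro w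
          conv_lhs => rw [← Complex.re_add_im c]
          rw [add_smul, mul_smul]; rfl
        have hi : P (Complex.I • v) - Complex.I • P (Complex.I • Complex.I • v)
            = Complex.I • (P v - Complex.I • P (Complex.I • v)) := by
          simp only [hII, map_neg, smul_sub, smul_neg]; abel
        simp only [RingHom.id_apply]
        rw [h2 (P v - _), h2 v, ← hi, ← hr, ← hr]
        simp only [map_add, smul_add]; abel
      cont := by fun_prop }
  have hRdef : ∀ v, R v = P v - Complex.I • P (Complex.I • v) := fun v => rfl
  -- promote real symmetry to complex symmetry
  have hsymm : ∀ F : BH H, (∀ v w, (⟪F v, w⟫_ℂ).re = (⟪v, F w⟫_ℂ).re) → IsSelfAdjoint F := by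
    intro F hF
    rw [ContinuousLinearMap.isSelfAdjoint_iff_isSymmetric]
    intro v w
    apply Complex.ext (hF v w)
    have := hF v (Complex.I • w)
    simp [inner_smul_right] at this
    simpa using this
  have hRre : ∀ v, (⟪R v, v⟫_ℂ).re = ‖P v‖ ^ 2 + ‖P (Complex.I • v)‖ ^ 2 := by
    intro v
    rw [hRdef, inner_sub_left, Complex.sub_re, hIre, sub_neg_eq_add, hPre, hPre (Complex.I • v)]
    rw [← inner_self_eq_norm_sq (𝕜 := ℂ) (P v), ← inner_self_eq_norm_sq (𝕜 := ℂ) (P (Complex.I • v))]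
    rfl
  have hRsa : IsSelfAdjoint R := by
    apply hsymm
    intro v w
    simp only [hRdef, inner_sub_left, inner_sub_right, Complex.sub_re, hPsym v w, hIre]
    rw [hPsym, hIre, neg_neg]
  have hDsa : IsSelfAdjoint D := by
    apply hsymm
    intro v w
    rw [hDdef, hDdef, ← hJ w, aux_antiinner, ← hAJ, hJ, ← inner_conj_symm, Complex.conj_re, hAsym]
  have hinj0 : ∀ v, P v = 0 → P (Complex.I • v) = 0 → v = 0 := by
    intro v h1 h2
    apply hb
    intro h hh
    have e1 := hP v h hh
    have e2 := hP (Complex.I • v) h hh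
    rw [h1, sub_zero] at e1
    rw [h2, sub_zero, inner_smul_left] at e2
    apply Complex.ext
    · simpa using e1
    · simpa using e2
  have hRinj : ∀ v, R v = 0 → v = 0 := by
    intro v hv
    have := hRre v
    rw [hv, inner_zero_left, Complex.zero_re] at this
    have h1 : ‖P v‖ ^ 2 = 0 := by nlinarith [sq_nonneg ‖P v‖, sq_nonneg ‖P (Complex.I • v)‖]
    have h2 : ‖P (Complex.I • v)‖ ^ 2 = 0 := by
      nlinarith [sq_nonneg ‖P v‖, sq_nonneg ‖P (Complex.I • v)‖]
    exact hinj0 v (norm_eq_zero.1 (by simpa using h1)) (norm_eq_zero.1 (by simpa using h2))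
  have hDinj : ∀ v, D v = 0 → v = 0 := by
    intro v hv
    have hA0 : A v = 0 := by
      rw [hDdef] at hv
      simpa using hv
    have h1 : P (Complex.I • v) = Complex.I • P v := by
      have := congrArg (fun w => Complex.I • w) hA0
      simp only [hAdef, smul_add, hII, smul_zero] at this
      rw [add_neg_eq_zero] at this
      exact this.symm
    have h2 : P v = 0 := ha _ (hPK v) (h1 ▸ hPK _)
    exact hinj0 v h2 (by rw [h1, h2, smul_zero])
  have hdense : ∀ F : BH H, IsSelfAdjoint F → (∀ v, F v = 0 → v = 0) → DenseRange F := by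
    intro F hF hi
    have : (LinearMap.range (F : H →ₗ[ℂ] H)).topologicalClosure = ⊤ := by
      rw [Submodule.topologicalClosure_eq_top_iff, Submodule.eq_bot_iff]
      intro v hv
      rw [Submodule.mem_orthogonal] at hv
      apply hi
      have := hv (F (F v)) ⟨F v, rfl⟩
      rw [aux_sa hF] at this
      simpa using this
    have h2 := congrArg (fun S : Submodule ℂ H => (S : Set H)) this
    simp only [Submodule.topologicalClosure_coe, Submodule.top_coe] at h2
    intro v
    have h3 : v ∈ closure ((LinearMap.range (F : H →ₗ[ℂ] H) : Submodule ℂ H) : Set H) := by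
      rw [h2]; trivial
    exact h3
  have hRpos : 0 ≤ R := by
    rw [aux_nonneg_iff]
    intro v
    rw [Complex.le_def]
    constructor
    · rw [← aux_sa hRsa, hRre]; simp; positivity
    · have : (starRingEnd ℂ) ⟪v, R v⟫_ℂ = ⟪v, R v⟫_ℂ := by
        rw [inner_conj_symm, aux_sa hRsa]
      exact (Complex.conj_eq_iff_im.1 this).symm
  have hRDpos : 0 ≤ R * D := by
    rw [aux_nonneg_iff]
    intro v
    have := hd _ (hPK v) _ (K.neg_mem (hPK (Complex.I • v)))
    rw [smul_neg, ← sub_eq_add_neg, sub_neg_eq_add, ← hAdef, ← hRdef, ← hJ (A v), aux_antiinner,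
      ← hDdef] at this
    rw [← inner_conj_symm, mul_apply_eq_comp, aux_sa hRsa]
    exact star_nonneg_iff.2 this
  have hcomm : Commute R D := by
    have := hRDpos.isSelfAdjoint.star_eq
    rw [star_mul, hRsa.star_eq, hDsa.star_eq] at this
    exact this.symm
  obtain ⟨r, hrsa, hrr, hrc⟩ := aux_sqrt hRpos
  have hrdense : DenseRange r := by
    apply hdense r hrsa
    intro v hv
    apply hRinj
    rw [← hrr, mul_apply_eq_comp, hv, map_zero]
  have hDpos : 0 ≤ D := by
    rw [aux_nonneg_iff]
    intro v
    refine hrdense.induction_on (p := fun v => 0 ≤ ⟪v, D v⟫_ℂ) v ?_ ?_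
    · exact isClosed_le continuous_const (by fun_prop)
    · intro w
      have h1 : D (r w) = r (D w) := (congrArg (fun T : BH H => T w) (hrc D hcomm).eq).symm
      have h2 : ⟪r w, D (r w)⟫_ℂ = ⟪w, (R * D) w⟫_ℂ := by
        rw [h1, aux_sa hrsa, ← hrr]; rfl
      rw [h2]
      exact (aux_nonneg_iff _).1 hRDpos w
  have heA : ∀ v, A (e v) = e (A v) := by
    intro v
    simp only [hAdef, map_add, map_smul, heP]
    rw [← map_smul e Complex.I v, heP]
  have heD2 : Commute (D * D) e := by
    ext v
    simp only [mul_apply_eq_comp, hDdef, ← hAJ, hJ, heA]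
  have heD : Commute D e := by
    have := aux_commute_sqrt heD2
    rwa [CFC.sqrt_mul_self D hDpos] at this
  have key : ∀ w, e w = J (e (J w)) := by
    intro w
    refine (hdense D hDsa hDinj).induction_on (p := fun w => e w = J (e (J w))) w ?_ ?_
    · exact isClosed_eq (by fun_prop) (J.continuous.comp (e.continuous.comp J.continuous))
    · intro v
      have h1 : e (D v) = D (e v) := (congrArg (fun T : BH H => T v) heD.eq).symm
      rw [h1, hDdef, hDdef, hJ, heA]
  rw [key (J ζ), hJ]

lemma aux_inner_self {X : Type*} [NormedAddCommGroup X] [InnerProductSpace ℂ X] (ζ : X) :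
    ⟪ζ, ζ⟫_ℂ = ((‖ζ‖ ^ 2 : ℝ) : ℂ) := by
  rw [inner_self_eq_norm_sq_to_K]; simp

lemma aux_proj {X : Type*} [NormedAddCommGroup X] [InnerProductSpace ℂ X] [CompleteSpace X]
    (S : Submodule ℂ X) : ∃ q : X →L[ℂ] X, (∀ v, q v ∈ Sᗮ) ∧ (∀ v w, w ∈ Sᗮ → ⟪v - q v, w⟫_ℂ = 0) ∧
      (∀ v, v ∈ Sᗮ → q v = v) ∧ (∀ u v, ⟪q u, v⟫_ℂ = ⟪u, q v⟫_ℂ) ∧ (∀ v, ‖q v‖ ≤ ‖v‖) ∧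
      (∀ u v, v ∈ Sᗮ → (∀ w ∈ Sᗮ, ⟪u - v, w⟫_ℂ = 0) → q u = v) := by
  have : CompleteSpace (Sᗮ : Submodule ℂ X) := (Submodule.isClosed_orthogonal S).completeSpace_coe
  exact ⟨Sᗮ.starProjection, fun v => Sᗮ.starProjection_apply_mem v,
    fun v w hw => Sᗮ.starProjection_inner_eq_zero v w hw,
    fun v hv => Submodule.starProjection_eq_self_iff.2 hv,
    fun u v => Sᗮ.inner_starProjection_left_eq_right u v,
    fun v => Sᗮ.norm_starProjection_apply_le v,
    fun u v hv h => Submodule.eq_starProjection_of_mem_of_inner_eq_zero hv h⟩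

lemma aux_density (𝒜 : StarSubalgebra ℂ (BH H)) (ξ : H)
    (hcyc : ∀ v, (∀ a ∈ 𝒜, ⟪a ξ, v⟫_ℂ = 0) → v = 0) (ζ : H)
    (h1 : ∀ a ∈ 𝒜, ⟪a ξ, ζ⟫_ℂ + ⟪a ζ, ξ⟫_ℂ = 0)
    (h2 : ∀ y : BH H, (∀ a ∈ 𝒜, a * y = y * a) → ⟪y ξ, ζ⟫_ℂ = ⟪y ζ, ξ⟫_ℂ) : ζ = 0 := by
  let Φ : 𝒜 →ₗ[ℂ] WithLp 2 (H × H) :=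
    { toFun := fun a => WithLp.toLp 2 ((a : BH H) ξ, (a : BH H) ζ)
      map_add' := fun a b => rfl
      map_smul' := fun c a => rfl }
  have hΦ : ∀ a : 𝒜, Φ a = WithLp.toLp 2 ((a : BH H) ξ, (a : BH H) ζ) := fun _ => rfl
  let N : Submodule ℂ (WithLp 2 (H × H)) := (LinearMap.range Φ)ᗮ
  have hN : ∀ v, v ∈ N ↔ ∀ a ∈ 𝒜, ⟪a ξ, v.fst⟫_ℂ + ⟪a ζ, v.snd⟫_ℂ = 0 := by
    intro v
    constructor
    · intro hv a ha
      have := (Submodule.mem_orthogonal _ _).1 hv (Φ ⟨a, ha⟩) ⟨_, rfl⟩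
      rw [WithLp.prod_inner_apply] at this
      exact this
    · intro hv
      refine (Submodule.mem_orthogonal _ _).2 ?_
      rintro _ ⟨a, rfl⟩
      rw [WithLp.prod_inner_apply]
      exact hv a a.2
  obtain ⟨q, hqN, hq0, hqfix, hqsym, hqnorm, hquniq⟩ := aux_proj (LinearMap.range Φ)
  change ∀ v, q v ∈ N at hqN
  change ∀ v w, w ∈ N → _ at hq0
  change ∀ v, v ∈ N → _ at hqfix
  change ∀ u v, v ∈ N → (∀ w ∈ N, _) → _ at hquniq
  have hqq : ∀ v, q (q v) = q v := fun v => hqfix _ (hqN v)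
  let dg : BH H → WithLp 2 (H × H) → WithLp 2 (H × H) := fun a v => WithLp.toLp 2 (a v.fst, a v.snd)
  have hdgN : ∀ a ∈ 𝒜, ∀ v ∈ N, dg a v ∈ N := by
    intro a ha v hv
    rw [hN] at hv ⊢
    intro c hc
    have := hv (star a * c) (mul_mem (star_mem ha) hc)
    simp only [mul_apply_eq_comp, aux_adj] at this
    exact this
  have hqdg : ∀ a ∈ 𝒜, ∀ v, q (dg a v) = dg a (q v) := by
    intro a ha v
    refine hquniq _ _ (hdgN a ha _ (hqN v)) ?_
    intro w hw
    have := hq0 v _ (hdgN (star a) (star_mem ha) w hw)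
    rw [WithLp.prod_inner_apply] at this ⊢
    simp only [dg, aux_adj'] at this
    rw [← this]
    simp [dg, inner_sub_left]
  let inl : H → WithLp 2 (H × H) := fun u => WithLp.toLp 2 (u, 0)
  let inr : H → WithLp 2 (H × H) := fun u => WithLp.toLp 2 (0, u)
  let a : BH H :=
    { toFun := fun u => (q (inl u)).fst
      map_add' := fun u v => by
        have : inl (u + v) = inl u + inl v := by
          simp only [inl, ← WithLp.toLp_add, Prod.mk_add_mk, add_zero]
        rw [this, map_add]; rfl
      map_smul' := fun c u => by
        have : inl (c • u) = c • inl u := by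
          simp only [inl, ← WithLp.toLp_smul, Prod.smul_mk, smul_zero]
        rw [this, map_smul]; rfl
      cont := by
        have : Continuous inl := by
          simp only [inl]; fun_prop
        fun_prop }
  let b : BH H :=
    { toFun := fun u => (q (inr u)).fst
      map_add' := fun u v => by
        have : inr (u + v) = inr u + inr v := by
          simp only [inr, ← WithLp.toLp_add, Prod.mk_add_mk, add_zero]
        rw [this, map_add]; rfl
      map_smul' := fun c u => by
        have : inr (c • u) = c • inr u := by
          simp only [inr, ← WithLp.toLp_smul, Prod.smul_mk, smul_zero]
        rw [this, map_smul]; rfl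
      cont := by
        have : Continuous inr := by
          simp only [inr]; fun_prop
        fun_prop }
  have hadef : ∀ u, a u = (q (inl u)).fst := fun _ => rfl
  have hbdef : ∀ u, b u = (q (inr u)).fst := fun _ => rfl
  have hacomm : ∀ c ∈ 𝒜, c * a = a * c := by
    intro c hc
    ext u
    have : dg c (inl u) = inl (c u) := by simp [dg, inl]
    simp only [mul_apply_eq_comp, hadef]
    rw [← this, hqdg c hc]; rfl
  have hbcomm : ∀ c ∈ 𝒜, c * b = b * c := by
    intro c hc
    ext u
    have : dg c (inr u) = inr (c u) := by simp [dg, inr]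
    simp only [mul_apply_eq_comp, hbdef]
    rw [← this, hqdg c hc]; rfl
  have hsplit : ∀ u v, a u + b v = (q (WithLp.toLp 2 (u, v))).fst := by
    intro u v
    have : (WithLp.toLp 2 (u, v) : WithLp 2 (H × H)) = inl u + inr v := by
      simp only [inl, inr, ← WithLp.toLp_add, Prod.mk_add_mk, add_zero, zero_add]
    rw [this, map_add]; rfl
  have hnorm : ∀ u, ⟪a u, u⟫_ℂ = (‖q (inl u)‖ ^ 2 : ℝ) := by
    intro u
    have h3 : ⟪a u, u⟫_ℂ = ⟪q (inl u), inl u⟫_ℂ := by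
      rw [WithLp.prod_inner_apply]; simp [inl, hadef]
    rw [h3, ← hqq, hqsym, hqq, inner_self_eq_norm_sq_to_K]; simp
  have e1 : a ξ + b ζ = 0 := by
    rw [hsplit]
    have h3 : q (WithLp.toLp 2 (ξ, ζ)) = 0 := by
      have h4 := (hN _).1 (hqN (WithLp.toLp 2 (ξ, ζ))) 1 (one_mem _)
      have h5 : ⟪WithLp.toLp 2 (ξ, ζ), q (WithLp.toLp 2 (ξ, ζ))⟫_ℂ = 0 := by
        rw [WithLp.prod_inner_apply]; exact h4
      rw [← hqq, ← hqsym, inner_self_eq_zero] at h5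
      exact h5
    rw [h3]; rfl
  have e2 : a ζ + b ξ = ζ := by
    rw [hsplit, hqfix (WithLp.toLp 2 (ζ, ξ)) ((hN _).2 h1)]; rfl
  have hlu : ∀ u, ‖inl u‖ = ‖u‖ := by
    intro u
    have : ‖inl u‖ ^ 2 = ‖u‖ ^ 2 := by
      rw [WithLp.prod_norm_sq_eq_of_L2]; simp [inl]
    exact (sq_eq_sq₀ (norm_nonneg _) (norm_nonneg _)).1 this
  have key : ‖q (inl ξ)‖ ^ 2 = ‖q (inl ζ)‖ ^ 2 - ‖ζ‖ ^ 2 := by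
    have h3 : ⟪a ξ, ξ⟫_ℂ = ⟪a ζ, ζ⟫_ℂ - ⟪ζ, ζ⟫_ℂ := by
      rw [eq_neg_of_add_eq_zero_left e1, inner_neg_left, ← h2 b hbcomm, eq_sub_of_add_eq' e2,
        inner_sub_left]
      ring
    rw [hnorm, hnorm, aux_inner_self] at h3
    exact_mod_cast h3
  have hle : ‖q (inl ζ)‖ ≤ ‖ζ‖ := (hqnorm _).trans_eq (hlu ζ)
  have hz : ‖q (inl ξ)‖ ^ 2 = 0 := by
    nlinarith [norm_nonneg (q (inl ζ)), norm_nonneg ζ, sq_nonneg ‖q (inl ξ)‖]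
  have haξ : a ξ = 0 := by
    rw [hadef, norm_eq_zero.1 (pow_eq_zero_iff two_ne_zero |>.1 hz)]; rfl
  have hasym : ∀ u v, ⟪a u, v⟫_ℂ = ⟪u, a v⟫_ℂ := by
    intro u v
    have h3 : ⟪a u, v⟫_ℂ = ⟪q (inl u), inl v⟫_ℂ := by
      rw [WithLp.prod_inner_apply]; simp [inl, hadef]
    have h4 : ⟪u, a v⟫_ℂ = ⟪inl u, q (inl v)⟫_ℂ := by
      rw [WithLp.prod_inner_apply]; simp [inl, hadef]
    rw [h3, h4, hqsym]
  have haζ : a ζ = 0 := by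
    apply hcyc
    intro c hc
    rw [← hasym]
    have : a (c ξ) = c (a ξ) := (congrArg (fun T : BH H => T ξ) (hacomm c hc)).symm
    rw [this, haξ]; simp
  have h5 := hnorm ζ
  rw [haζ, inner_zero_left] at h5
  have h6 : ‖q (inl ζ)‖ ^ 2 = 0 := by exact_mod_cast h5.symm
  have h7 : ‖ζ‖ ^ 2 = 0 := by linarith
  exact norm_eq_zero.1 (pow_eq_zero_iff two_ne_zero |>.1 h7)

lemma aux_decomp (𝒜 : StarSubalgebra ℂ (BH H)) (a : BH H) (ha : a ∈ 𝒜) :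
    ∃ x ∈ 𝒜, ∃ y ∈ 𝒜, IsSelfAdjoint x ∧ IsSelfAdjoint y ∧ a = x + Complex.I • y := by
  refine ⟨(1 / 2 : ℂ) • (a + star a), 𝒜.smul_mem (add_mem ha (star_mem ha)) _,
    (-Complex.I / 2 : ℂ) • (a - star a), 𝒜.smul_mem (sub_mem ha (star_mem ha)) _, ?_, ?_, ?_⟩
  · rw [isSelfAdjoint_iff]; simp [add_comm]
  · rw [isSelfAdjoint_iff]; simp [smul_sub, neg_div, div_eq_mul_inv]; abel
  · rw [smul_smul]
    have : Complex.I * (-Complex.I / 2) = 1 / 2 := by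
      linear_combination (-1 / 2 : ℂ) * Complex.I_mul_I
    rw [this, ← smul_add]
    have : a + star a + (a - star a) = (2 : ℂ) • a := by rw [two_smul]; abel
    rw [this, smul_smul]; norm_num

lemma aux_density' (𝒜 : StarSubalgebra ℂ (BH H)) (ξ : H)
    (hcyc : ∀ v, (∀ a ∈ 𝒜, ⟪a ξ, v⟫_ℂ = 0) → v = 0) (ζ : H)
    (h1 : ∀ a ∈ 𝒜, IsSelfAdjoint a → (⟪a ξ, ζ⟫_ℂ).re = 0)
    (h2 : ∀ y : BH H, (∀ a ∈ 𝒜, a * y = y * a) → IsSelfAdjoint y → (⟪y ξ, ζ⟫_ℂ).im = 0) :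
    ζ = 0 := by
  have g1 : ∀ a ∈ 𝒜, IsSelfAdjoint a → ⟪a ξ, ζ⟫_ℂ + ⟪a ζ, ξ⟫_ℂ = 0 := by
    intro a ha hsa
    rw [aux_sa hsa ζ, ← inner_conj_symm ζ]
    have := h1 a ha hsa
    generalize ⟪a ξ, ζ⟫_ℂ = z at *
    apply Complex.ext <;> simp [this]
  have g2 : ∀ y : BH H, (∀ a ∈ 𝒜, a * y = y * a) → IsSelfAdjoint y →
      ⟪y ξ, ζ⟫_ℂ = ⟪y ζ, ξ⟫_ℂ := by
    intro a ha hsa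
    rw [aux_sa hsa ζ, ← inner_conj_symm ζ]
    have := h2 a ha hsa
    generalize ⟪a ξ, ζ⟫_ℂ = z at *
    apply Complex.ext <;> simp [this]
  apply aux_density 𝒜 ξ hcyc ζ
  · intro a ha
    obtain ⟨x, hx, y, hy, hxs, hys, rfl⟩ := aux_decomp 𝒜 a ha
    simp only [ContinuousLinearMap.add_apply, ContinuousLinearMap.smul_apply, inner_add_left,
      inner_smul_left]
    linear_combination g1 x hx hxs + (starRingEnd ℂ Complex.I) * g1 y hy hys
  · intro a ha
    have hc : ∀ z : BH H, z ∈ StarSubalgebra.centralizer ℂ (𝒜 : Set (BH H)) ↔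
        ∀ a ∈ 𝒜, a * z = z * a := by
      intro z
      rw [StarSubalgebra.mem_centralizer_iff]
      exact ⟨fun h a ha => (h a ha).1, fun h a ha => ⟨h a ha, h _ (star_mem ha)⟩⟩
    obtain ⟨x, hx, y, hy, hxs, hys, rfl⟩ := aux_decomp _ a ((hc a).2 ha)
    simp only [ContinuousLinearMap.add_apply, ContinuousLinearMap.smul_apply, inner_add_left,
      inner_smul_left]
    linear_combination g2 x ((hc x).1 hx) hxs + (starRingEnd ℂ Complex.I) * g2 y ((hc y).1 hy) hys

lemma aux_closure_zero {f : H → ℝ} (hf : Continuous f) {S : Set H} (h : ∀ x ∈ S, f x = 0)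
    {x : H} (hx : x ∈ closure S) : f x = 0 :=
  closure_minimal (t := {x | f x = 0}) h (isClosed_eq hf continuous_const) hx

lemma aux_conjJ (J : H ≃ₗᵢ⋆[ℂ] H) (hJ : ∀ ξ, J (J ξ) = ξ) (T : BH H) (v : H) :
    conjJ J T v = J (T (J v)) := by
  have : J.symm v = J v := by
    rw [LinearIsometryEquiv.symm_apply_eq, hJ]
  change J (T (J.symm v)) = _
  rw [this]

lemma aux_conjJ_star (J : H ≃ₗᵢ⋆[ℂ] H) (hJ : ∀ ξ, J (J ξ) = ξ) (T : BH H) :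
    star (conjJ J T) = conjJ J (star T) := by
  ext v
  apply ext_inner_right ℂ
  intro w
  have h : ∀ a b, ⟪J a, b⟫_ℂ = ⟪J b, a⟫_ℂ := by
    intro a b
    conv_lhs => rw [← hJ b]
    exact aux_antiinner J a (J b)
  rw [aux_adj, aux_conjJ J hJ, aux_conjJ J hJ, h (star T (J v)), aux_adj', ← inner_conj_symm, h,
    inner_conj_symm]

lemma aux_J_comm_sf (M : VonNeumannAlgebra H) (sf : StandardForm M) (ξ : H) (hξ : ξ ∈ sf.cone)
    (𝒜 : StarSubalgebra ℂ (BH H)) (hAM : ∀ a ∈ 𝒜, a ∈ (M : Set (BH H)))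
    (hAc : ∀ y : BH H, (∀ a ∈ 𝒜, a * y = y * a) → y ∈ Set.centralizer (M : Set (BH H)))
    (hcyc : ∀ v, (∀ a ∈ 𝒜, ⟪a ξ, v⟫_ℂ = 0) → v = 0)
    (e : BH H) (he : IsSelfAdjoint e)
    (heA : ∀ a ∈ 𝒜, IsSelfAdjoint a → e (a ξ) ∈
      closure {v | ∃ b ∈ 𝒜, IsSelfAdjoint b ∧ b ξ = v}) (ζ : H) :
    e (sf.J ζ) = sf.J (e ζ) := by
  obtain ⟨J, cone, hJ, hJc, hcom, hsd, hci⟩ := sf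
  simp only at hξ ⊢
  have hJξ : J ξ = ξ := hJc ξ hξ
  let K0 : Submodule ℝ H :=
    { carrier := {v | ∃ b ∈ 𝒜, IsSelfAdjoint b ∧ b ξ = v}
      add_mem' := by
        rintro _ _ ⟨a, ha, ha', rfl⟩ ⟨b, hb, hb', rfl⟩
        exact ⟨a + b, add_mem ha hb, ha'.add hb', rfl⟩
      zero_mem' := ⟨0, zero_mem _, IsSelfAdjoint.zero _, rfl⟩
      smul_mem' := by
        rintro c _ ⟨a, ha, ha', rfl⟩
        refine ⟨(c : ℂ) • a, 𝒜.smul_mem ha _, ?_, ?_⟩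
        · rw [isSelfAdjoint_iff, star_smul, ha'.star_eq]; simp
        · simp }
  have hK0 : ∀ v, v ∈ K0 ↔ ∃ b ∈ 𝒜, IsSelfAdjoint b ∧ b ξ = v := fun v => Iff.rfl
  let K := K0.topologicalClosure
  have hKcl : IsClosed (K : Set H) := K0.isClosed_topologicalClosure
  have hKmem : ∀ v, v ∈ K ↔ v ∈ closure (K0 : Set H) := fun v => by
    rw [← Submodule.topologicalClosure_coe]; rfl
  have hsub : ∀ v ∈ K0, v ∈ K := fun v hv => K0.le_topologicalClosure hv
  have hcl : ∀ f : H → ℝ, Continuous f → (∀ b ∈ 𝒜, IsSelfAdjoint b → f (b ξ) = 0) →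
      ∀ h ∈ K, f h = 0 := by
    intro f hf hb h hh
    refine aux_closure_zero hf ?_ ((hKmem h).1 hh)
    rintro _ ⟨b, hb1, hb2, rfl⟩
    exact hb b hb1 hb2
  have hmul : ∀ (a b : BH H) v, a * b = b * a → a (b v) = b (a v) := fun a b v h =>
    congrArg (fun T : BH H => T v) h
  have hJinner : ∀ a b, ⟪J a, b⟫_ℂ = ⟪J b, a⟫_ℂ := by
    intro a b
    conv_lhs => rw [← hJ b]
    exact aux_antiinner J a (J b)
  have hJm : ∀ m ∈ (M : Set (BH H)), conjJ J m ∈ Set.centralizer (M : Set (BH H)) := by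
    intro m hm; rw [hcom]; exact ⟨m, hm, rfl⟩
  have hJmξ : ∀ m : BH H, conjJ J m ξ = J (m ξ) := by
    intro m; rw [aux_conjJ J hJ, hJξ]
  have hJsa : ∀ m : BH H, IsSelfAdjoint m → IsSelfAdjoint (conjJ J m) := by
    intro m hm; rw [isSelfAdjoint_iff, aux_conjJ_star J hJ, hm.star_eq]
  -- imaginary parts vanish
  have him0 : ∀ m ∈ (M : Set (BH H)), IsSelfAdjoint m → ∀ y ∈ Set.centralizer (M : Set (BH H)),
      IsSelfAdjoint y → (⟪m ξ, y ξ⟫_ℂ).im = 0 := by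
    intro m hm hms y hy hys
    have h1 : ⟪m ξ, y ξ⟫_ℂ = ⟪y ξ, m ξ⟫_ℂ := by
      rw [aux_sa hms, hmul m y ξ (hy m hm), ← aux_sa hys]
    rw [← inner_conj_symm] at h1
    have h2 := Complex.conj_eq_iff_im.1 h1
    rw [← inner_conj_symm, Complex.conj_im, h2, neg_zero]
  have him : ∀ h ∈ K, ∀ y ∈ Set.centralizer (M : Set (BH H)),
      IsSelfAdjoint y → (⟪h, y ξ⟫_ℂ).im = 0 := by
    intro h hh y hy hys
    exact hcl (fun h => (⟪h, y ξ⟫_ℂ).im) (by fun_prop)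
      (fun b hb hbs => him0 b (hAM b hb) hbs y hy hys) h hh
  have him' : ∀ h ∈ K, ∀ y ∈ Set.centralizer (M : Set (BH H)),
      IsSelfAdjoint y → (⟪y ξ, h⟫_ℂ).im = 0 := by
    intro h hh y hy hys
    rw [← inner_conj_symm, Complex.conj_im, him h hh y hy hys, neg_zero]
  obtain ⟨P, hPmem, hPperp⟩ : ∃ P : H → H, (∀ v, P v ∈ K) ∧
      ∀ v, ∀ h ∈ K, (⟪h, v - P v⟫_ℂ).re = 0 := by
    obtain ⟨P, h1, h2⟩ := aux_real_proj K hKcl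
    refine ⟨P, h1, fun v h hh => ?_⟩
    rw [← inner_conj_symm, Complex.conj_re]
    exact h2 v h hh
  have hproj : ∀ v, (∀ y ∈ Set.centralizer (M : Set (BH H)),
      IsSelfAdjoint y → (⟪y ξ, v⟫_ℂ).im = 0) → v ∈ K := by
    intro v hv
    have : v - P v = 0 := by
      apply aux_density' 𝒜 ξ hcyc
      · intro a ha has
        exact hPperp v _ (hsub _ ⟨a, ha, has, rfl⟩)
      · intro y hy hys
        rw [inner_sub_right, Complex.sub_im, hv y (hAc y hy) hys, him' _ (hPmem v) y (hAc y hy) hys,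
          sub_zero]
    rw [sub_eq_zero.1 this]; exact hPmem v
  have hMK : ∀ m ∈ (M : Set (BH H)), IsSelfAdjoint m → m ξ ∈ K := by
    intro m hm hms
    apply hproj
    intro y hy hys
    rw [← inner_conj_symm, Complex.conj_im, him0 m hm hms y hy hys, neg_zero]
  have hortho : ∀ v, (∀ b ∈ 𝒜, IsSelfAdjoint b → ⟪b ξ, v⟫_ℂ = 0) → v = 0 := by
    intro v hv
    apply hcyc
    intro a ha
    obtain ⟨x, hx, y, hy, hxs, hys, rfl⟩ := aux_decomp 𝒜 a ha
    simp only [ContinuousLinearMap.add_apply, ContinuousLinearMap.smul_apply, inner_add_left,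
      inner_smul_left, hv x hx hxs, hv y hy hys]
    simp
  have hreJ : ∀ m ∈ (M : Set (BH H)), IsSelfAdjoint m → ∀ h ∈ K, (⟪J (m ξ), h⟫_ℂ).im = 0 := by
    intro m hm hms h hh
    rw [← hJmξ]
    exact him' h hh _ (hJm m hm) (hJsa m hms)
  refine aux_J_comm J hJ K hKcl ?_ ?_ ?_ ?_ ?_ e he ?_ ζ
  · intro h hh hIh
    have : J h = 0 := by
      apply hortho
      intro b hb hbs
      rw [← inner_conj_symm, hJinner]
      have h1 := hreJ b (hAM b hb) hbs h hh
      have h2 := hreJ b (hAM b hb) hbs _ hIh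
      rw [inner_smul_right] at h2
      have : ⟪J (b ξ), h⟫_ℂ = 0 := by
        apply Complex.ext
        · simpa using h2
        · simpa using h1
      simp [this]
    rw [← hJ h, this, map_zero]
  · intro v hv
    apply hortho
    intro b hb hbs
    rw [← inner_conj_symm, hv _ (hsub _ ⟨b, hb, hbs, rfl⟩), map_zero]
  · intro h hh k hk
    refine hcl (fun h => (⟪Complex.I • J h, k⟫_ℂ).re) (by fun_prop) ?_ h hh
    intro b hb hbs
    have := hreJ b (hAM b hb) hbs k hk
    rw [inner_smul_left]
    simp [this]
  · intro v hv
    apply hproj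
    intro y hy hys
    rw [hcom] at hy
    obtain ⟨m, hm, rfl⟩ := hy
    have hms : IsSelfAdjoint m := by
      rw [isSelfAdjoint_iff]
      have h1 := hys.star_eq
      rw [aux_conjJ_star J hJ] at h1
      ext w
      have h2 := congrArg (fun T : BH H => J (T (J w))) h1
      simpa [aux_conjJ J hJ, hJ] using h2
    have := hv _ (hMK m hm hms)
    rw [hJmξ, inner_smul_right, aux_antiinner]
    simpa using this
  · intro h hh k hk
    have hcl2 : IsClosed {p : H × H | 0 ≤ ⟪J (p.1 + Complex.I • p.2), p.1 - Complex.I • p.2⟫_ℂ} := by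
      refine isClosed_le continuous_const ?_
      fun_prop
    have hsub2 : (K0 : Set H) ×ˢ (K0 : Set H) ⊆
        {p : H × H | 0 ≤ ⟪J (p.1 + Complex.I • p.2), p.1 - Complex.I • p.2⟫_ℂ} := by
      rintro ⟨_, _⟩ ⟨⟨x, hx, hxs, rfl⟩, ⟨y, hy, hys, rfl⟩⟩
      have haA : x + Complex.I • y ∈ 𝒜 := add_mem hx (𝒜.smul_mem hy _)
      have h1 := hci _ (hAM _ haA) ξ hξ
      rw [hsd] at h1
      have h2 := h1 ξ hξ
      rw [hJmξ, ← aux_adj'] at h2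
      have h3 : star (x + Complex.I • y) = x - Complex.I • y := by
        simp [hxs.star_eq, hys.star_eq, sub_eq_add_neg]
      rw [h3] at h2
      exact h2
    have := closure_minimal hsub2 hcl2
    rw [closure_prod_eq] at this
    exact this (a := (h, k)) ⟨(hKmem h).1 hh, (hKmem k).1 hk⟩
  · intro h hh
    have : (K0 : Set H) ⊆ e ⁻¹' (K : Set H) := by
      rintro _ ⟨a, ha, has, rfl⟩
      exact (hKmem _).2 (heA a ha has)
    exact closure_minimal this (hKcl.preimage e.continuous) ((hKmem h).1 hh)

lemma vn_smul (N : VonNeumannAlgebra H) (c : ℂ) {x : BH H} (hx : x ∈ N) : c • x ∈ N :=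
  N.toStarSubalgebra.smul_mem hx c

lemma vn_decomp (N : VonNeumannAlgebra H) (a : BH H) (ha : a ∈ N) :
    ∃ x ∈ N, ∃ y ∈ N, IsSelfAdjoint x ∧ IsSelfAdjoint y ∧ a = x + Complex.I • y :=
  aux_decomp N.toStarSubalgebra a ha

section ce
variable {N P : VonNeumannAlgebra H} {E : BH H → BH H}
  (h : IsCondExp (N : Set (BH H)) (P : Set (BH H)) E)
include h

lemma ce_sub {x y : BH H} (hx : x ∈ N) (hy : y ∈ N) : E (x - y) = E x - E y := by
  have h1 := h.map_smul (-1) y hy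
  have h2 := h.map_add x hx ((-1 : ℂ) • y) (vn_smul N _ hy)
  rw [h1] at h2
  simpa [sub_eq_add_neg] using h2

lemma ce_left {b x : BH H} (hb : b ∈ P) (hx : x ∈ N) : E (b * x) = b * E x := by
  have := h.bimod b hb 1 (one_mem P) x hx
  simpa using this

lemma ce_right {b x : BH H} (hb : b ∈ P) (hx : x ∈ N) : E (x * b) = E x * b := by
  have := h.bimod 1 (one_mem P) b hb x hx
  simpa using this

lemma ce_idem {x : BH H} (hx : x ∈ N) : E (x - E x) = 0 := by
  have h1 : E x ∈ P := h.maps_to x hx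
  rw [ce_sub h hx (h.subset h1), h.fixes _ h1, sub_self]

lemma ce_sa {x : BH H} (hx : x ∈ N) (hs : IsSelfAdjoint x) : IsSelfAdjoint (E x) := by
  have h1 : (algebraMap ℝ (BH H) ‖x‖) ∈ N := by
    have : algebraMap ℝ (BH H) ‖x‖ = (‖x‖ : ℂ) • (1 : BH H) := by
      rw [Algebra.algebraMap_eq_smul_one]; simp
    rw [this]; exact vn_smul N _ (one_mem N)
  have h1' : (algebraMap ℝ (BH H) ‖x‖) ∈ P := by
    have : algebraMap ℝ (BH H) ‖x‖ = (‖x‖ : ℂ) • (1 : BH H) := by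
      rw [Algebra.algebraMap_eq_smul_one]; simp
    rw [this]; exact vn_smul P _ (one_mem P)
  have h2 := h.pos _ (sub_mem h1 hx) (sub_nonneg.2 hs.le_algebraMap_norm_self)
  rw [ce_sub h h1 hx, h.fixes _ h1'] at h2
  have h3 : IsSelfAdjoint (algebraMap ℝ (BH H) ‖x‖) := IsSelfAdjoint.algebraMap _ (.all _)
  have h4 := h3.sub (IsSelfAdjoint.of_nonneg h2)
  simpa using h4

lemma ce_star {x : BH H} (hx : x ∈ N) : E (star x) = star (E x) := by
  obtain ⟨a, ha, b, hb, has, hbs, rfl⟩ := vn_decomp N x hx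
  have h1 : star (a + Complex.I • b) = a + (-Complex.I) • b := by
    simp [has.star_eq, hbs.star_eq]
  rw [h1, h.map_add _ ha _ (vn_smul N _ hb), h.map_add _ ha _ (vn_smul N _ hb),
    h.map_smul _ _ hb, h.map_smul _ _ hb]
  simp [(ce_sa h ha has).star_eq, (ce_sa h hb hbs).star_eq]
end ce

/-- the letter algebra -/
def Lt (M₁ M₂ : VonNeumannAlgebra H) (i : Bool) : VonNeumannAlgebra H := if i then M₁ else M₂

/-- reduced words starting with a letter of type `i` -/
inductive Red (M₁ M₂ : VonNeumannAlgebra H) (E : BH H → BH H) : Bool → BH H → Prop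
  | single (i : Bool) (x : BH H) : x ∈ Lt M₁ M₂ i → E x = 0 → Red M₁ M₂ E i x
  | cons (i : Bool) (x w : BH H) : x ∈ Lt M₁ M₂ i → E x = 0 → Red M₁ M₂ E (!i) w →
      Red M₁ M₂ E i (x * w)

lemma mem_Lt {M₁ M₂ : VonNeumannAlgebra H} (i : Bool) (x : BH H) :
    x ∈ Lt M₁ M₂ i ↔ x ∈ (if i then (M₁ : Set (BH H)) else (M₂ : Set (BH H))) := by
  cases i <;> rfl

lemma red_fin {M₁ M₂ : VonNeumannAlgebra H} {E : BH H → BH H} {i : Bool} {w : BH H}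
    (hw : Red M₁ M₂ E i w) : ∃ (n : ℕ) (x : Fin n → BH H) (ι : Fin n → Bool) (hn : 0 < n),
    (∀ k, x k ∈ (if ι k then (M₁ : Set (BH H)) else (M₂ : Set (BH H))) ∧ E (x k) = 0) ∧
    (∀ (k : ℕ) (h : k + 1 < n), ι ⟨k, Nat.lt_of_succ_lt h⟩ ≠ ι ⟨k + 1, h⟩) ∧
    ι ⟨0, hn⟩ = i ∧ w = (List.ofFn x).prod := by
  induction hw with
  | single i x hx hE =>
    refine ⟨1, fun _ => x, fun _ => i, one_pos, fun _ => ⟨(mem_Lt i x).1 hx, hE⟩, ?_, rfl, ?_⟩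
    · intro k hk; omega
    · simp
  | cons i x w hx hE hw ih =>
    obtain ⟨n, y, ι, hn, h1, h2, h3, rfl⟩ := ih
    refine ⟨n + 1, Fin.cons x y, Fin.cons i ι, Nat.succ_pos n, ?_, ?_, rfl, ?_⟩
    · intro k
      refine Fin.cases ?_ ?_ k
      · exact ⟨(mem_Lt i x).1 hx, hE⟩
      · intro k; exact h1 k
    · intro k hk
      cases k with
      | zero =>
        have : (Fin.cons i ι : Fin (n + 1) → Bool) ⟨0 + 1, hk⟩ = ι ⟨0, hn⟩ := rfl
        rw [this, h3]
        change i ≠ !i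
        simp
      | succ k => exact h2 k (by omega)
    · rw [List.ofFn_succ]; simp

lemma fin_red {M₁ M₂ : VonNeumannAlgebra H} {E : BH H → BH H} (n : ℕ) :
    ∀ (x : Fin n → BH H) (ι : Fin n → Bool) (hn : 0 < n),
    (∀ k, x k ∈ (if ι k then (M₁ : Set (BH H)) else (M₂ : Set (BH H))) ∧ E (x k) = 0) →
    (∀ (k : ℕ) (h : k + 1 < n), ι ⟨k, Nat.lt_of_succ_lt h⟩ ≠ ι ⟨k + 1, h⟩) →
    Red M₁ M₂ E (ι ⟨0, hn⟩) (List.ofFn x).prod := by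
  induction n with
  | zero => intro x ι hn; omega
  | succ n ih =>
    intro x ι hn h1 h2
    rw [List.ofFn_succ, List.prod_cons]
    rcases Nat.eq_zero_or_pos n with rfl | hpos
    · simp only [List.ofFn_zero, List.prod_nil, mul_one]
      exact Red.single _ _ ((mem_Lt _ _).2 (h1 0).1) (h1 0).2
    · refine Red.cons _ _ _ ((mem_Lt _ _).2 (h1 0).1) (h1 0).2 ?_
      have h3 := ih (fun k => x k.succ) (fun k => ι k.succ) hpos (fun k => h1 k.succ)
        (fun k hk => h2 (k + 1) (by omega))
      have h4 := h2 0 (by omega)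
      have h5 : ι (Fin.succ ⟨0, hpos⟩) = !(ι ⟨0, hn⟩) := by
        change ι ⟨0 + 1, _⟩ = _
        generalize ι ⟨0 + 1, _⟩ = a at *
        generalize ι ⟨0, _⟩ = b at *
        cases a <;> cases b <;> simp_all
      rw [h5] at h3
      exact h3

lemma red_words (M₁ M₂ : VonNeumannAlgebra H) (E : BH H → BH H) :
    ReducedWordsStartM₂ M₁ M₂ E = {w | Red M₁ M₂ E false w} := by
  ext w
  constructor
  · rintro ⟨n, x, ι, hn, h1, h2, h3, rfl⟩
    have := fin_red n x ι hn h1 h2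
    rw [h3] at this
    exact this
  · intro hw; exact red_fin hw

section afp
variable {M M₁ M₂ B : VonNeumannAlgebra H} {E : BH H → BH H} (h : IsAFP M M₁ M₂ B E)
include h

lemma afp_Lt {i : Bool} {x : BH H} (hx : x ∈ Lt M₁ M₂ i) : x ∈ M := by
  cases i
  · exact h.le₂M hx
  · exact h.le₁M hx

lemma afp_B {i : Bool} {x : BH H} (hx : x ∈ B) : x ∈ Lt M₁ M₂ i := by
  cases i
  · exact h.le₂ hx
  · exact h.le₁ hx

lemma afp_BM {x : BH H} (hx : x ∈ B) : x ∈ M := h.le₁M (h.le₁ hx)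

lemma afp_E {x : BH H} (hx : x ∈ M) : E x ∈ B := h.condExp.maps_to x hx

lemma red_mem {i : Bool} {w : BH H} (hw : Red M₁ M₂ E i w) : w ∈ M := by
  induction hw with
  | single i x hx hE => exact afp_Lt h hx
  | cons i x w hx hE hw ih => exact mul_mem (afp_Lt h hx) ih

lemma red_E {i : Bool} {w : BH H} (hw : Red M₁ M₂ E i w) : E w = 0 := by
  obtain ⟨n, x, ι, hn, h1, h2, h3, rfl⟩ := red_fin hw
  exact h.free n x ι hn h1 h2

lemma red_circ {i : Bool} {x : BH H} (hx : x ∈ Lt M₁ M₂ i) : Red M₁ M₂ E i (x - E x) :=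
  Red.single _ _ (sub_mem hx (afp_B h (afp_E h (afp_Lt h hx)))) (ce_idem h.condExp (afp_Lt h hx))

lemma red_circ_mul {i : Bool} {x w : BH H} (hx : x ∈ Lt M₁ M₂ i) (hw : Red M₁ M₂ E (!i) w) :
    Red M₁ M₂ E i ((x - E x) * w) :=
  Red.cons _ _ _ (sub_mem hx (afp_B h (afp_E h (afp_Lt h hx))))
    (ce_idem h.condExp (afp_Lt h hx)) hw

lemma red_B {i : Bool} {b w : BH H} (hb : b ∈ B) (hw : Red M₁ M₂ E i w) :
    Red M₁ M₂ E i (b * w) := by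
  cases hw with
  | single _ _ hx hE =>
    refine Red.single _ _ (mul_mem (afp_B h hb) hx) ?_
    rw [ce_left h.condExp hb (afp_Lt h hx), hE, mul_zero]
  | cons _ x w hx hE hw =>
    rw [← mul_assoc]
    refine Red.cons _ _ _ (mul_mem (afp_B h hb) hx) ?_ hw
    rw [ce_left h.condExp hb (afp_Lt h hx), hE, mul_zero]

lemma red_ortho {i : Bool} {w : BH H} (hw : Red M₁ M₂ E i w) :
    ∀ v, Red M₁ M₂ E (!i) v → E (star w * v) = 0 := by
  have hst : ∀ {i : Bool} {x v : BH H}, x ∈ Lt M₁ M₂ i → E x = 0 → Red M₁ M₂ E (!i) v →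
      Red M₁ M₂ E i (star x * v) := by
    intro i x v hx hE hv
    refine Red.cons _ _ _ (star_mem hx) ?_ hv
    rw [ce_star h.condExp (afp_Lt h hx), hE, star_zero]
  induction hw with
  | single i x hx hE => intro v hv; exact red_E h (hst hx hE hv)
  | cons i x w hx hE hw ih =>
    intro v hv
    rw [star_mul, mul_assoc]
    apply ih
    rw [Bool.not_not]
    exact hst hx hE hv

/-- right multiplication by `M₁` -/
lemma red_right {i : Bool} {w y : BH H} (hw : Red M₁ M₂ E i w) (hy : y ∈ M₁) :
    ∃ u ∈ Submodule.span ℂ {w | Red M₁ M₂ E i w}, ∃ b ∈ B, w * y = u + b ∧ (i = false → b = 0) := by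
  have hy' : y ∈ Lt M₁ M₂ true := hy
  induction hw with
  | single i x hx hE =>
    cases i with
    | true =>
      have h1 : x * y ∈ Lt M₁ M₂ true := mul_mem hx hy
      exact ⟨_, Submodule.subset_span (red_circ h h1), E (x * y), afp_E h (afp_Lt h h1), by simp,
        by simp⟩
    | false =>
      refine ⟨x * (y - E y) + x * E y, add_mem ?_ ?_, 0, zero_mem _, ?_, by simp⟩
      · exact Submodule.subset_span (Red.cons _ _ _ hx hE (red_circ h hy'))
      · have h1 := afp_E h (afp_Lt h hy')
        refine Submodule.subset_span (Red.single _ _ (mul_mem hx (afp_B h h1)) ?_)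
        rw [ce_right h.condExp h1 (afp_Lt h hx), hE, zero_mul]
      · rw [← mul_add]; simp
  | cons i x w hx hE hw ih =>
    obtain ⟨u, hu, b, hb, h1, h2⟩ := ih
    have h3 : x * u ∈ Submodule.span ℂ {w | Red M₁ M₂ E i w} := by
      refine Submodule.span_induction (p := fun u _ => x * u ∈ Submodule.span ℂ {w | Red M₁ M₂ E i w})
        ?_ ?_ ?_ ?_ hu
      · intro v hv; exact Submodule.subset_span (Red.cons _ _ _ hx hE hv)
      · simp
      · intro a b _ _ ha hb; rw [mul_add]; exact add_mem ha hb
      · intro c a _ ha; rw [mul_smul_comm]; exact Submodule.smul_mem _ _ ha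
    refine ⟨x * u + x * b, add_mem h3 ?_, 0, zero_mem _, ?_, by simp⟩
    · refine Submodule.subset_span (Red.single _ _ (mul_mem hx (afp_B h hb)) ?_)
      rw [ce_right h.condExp hb (afp_Lt h hx), hE, zero_mul]
    · rw [mul_assoc, h1, mul_add, add_zero]

lemma red_right_false {w y : BH H} (hw : Red M₁ M₂ E false w) (hy : y ∈ M₁) :
    w * y ∈ Submodule.span ℂ {w | Red M₁ M₂ E false w} := by
  obtain ⟨u, hu, b, hb, h1, h2⟩ := red_right h hw hy
  rw [h1, h2 rfl, add_zero]; exact hu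

lemma red_E_left {w m : BH H} (hw : Red M₁ M₂ E false w) (hm : m ∈ M₁) : E (m * w) = 0 := by
  have hm' : m ∈ Lt M₁ M₂ true := hm
  have h1 := red_circ_mul h hm' hw
  have h2 := red_B h (afp_E h (afp_Lt h hm')) hw
  have h3 : m * w = (m - E m) * w + E m * w := by rw [← add_mul]; simp
  rw [h3, h.condExp.map_add _ (red_mem h h1) _ (red_mem h h2), red_E h h1, red_E h h2, add_zero]
end afp

lemma aux_ortho_closure {S : Set H} {v : H} (hS : ∀ s ∈ S, ⟪s, v⟫_ℂ = 0) {u : H}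
    (hu : u ∈ closure S) : ⟪u, v⟫_ℂ = 0 :=
  closure_minimal (t := {u | ⟪u, v⟫_ℂ = 0}) hS
    (isClosed_eq (by fun_prop) continuous_const) hu

lemma aux_proj_zero {P : BH H} (hP : IsSelfAdjoint P) {S : Set H} (hr : ∀ η, P η ∈ closure S)
    (hf : ∀ η ∈ closure S, P η = η)
    {v : H} (hv : ∀ s ∈ S, ⟪s, v⟫_ℂ = 0) : P v = 0 := by
  have h1 := aux_ortho_closure hv (hr v)
  rw [← hf _ (hr v), aux_sa hP, inner_self_eq_zero] at h1
  exact h1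

/-- the standing assumptions -/
structure Setup (M M₁ M₂ B : VonNeumannAlgebra H) (E : BH H → BH H) (sf : StandardForm M) (ξ : H)
    (P₁ PB PK : BH H) : Prop where
  afp : IsAFP M M₁ M₂ B E
  hξ : ξ ∈ sf.cone
  cyc : ∀ v, (∀ m ∈ M, ⟪m ξ, v⟫_ℂ = 0) → v = 0
  sep : ∀ x ∈ M, x ξ = 0 → x = 0
  phiE : ∀ x ∈ M, ⟪ξ, (E x) ξ⟫_ℂ = ⟪ξ, x ξ⟫_ℂ
  P1s : IsSelfAdjoint P₁
  P1r : ∀ η : H, P₁ η ∈ closure {η : H | ∃ x ∈ M₁, x ξ = η}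
  P1f : ∀ η ∈ closure {η : H | ∃ x ∈ M₁, x ξ = η}, P₁ η = η
  PBs : IsSelfAdjoint PB
  PBr : ∀ η : H, PB η ∈ closure {η : H | ∃ x ∈ B, x ξ = η}
  PBf : ∀ η ∈ closure {η : H | ∃ x ∈ B, x ξ = η}, PB η = η
  PKs : IsSelfAdjoint PK
  PKr : ∀ η : H, PK η ∈ closure (Submodule.span ℂ
      ((fun w : BH H => w ξ) '' {w | Red M₁ M₂ E false w}) : Set H)
  PKf : ∀ η ∈ closure (Submodule.span ℂ
      ((fun w : BH H => w ξ) '' {w | Red M₁ M₂ E false w}) : Set H), PK η = η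

/-- the span of `M₁ W₂` -/
def Rsp (M₁ M₂ : VonNeumannAlgebra H) (E : BH H → BH H) : Submodule ℂ (BH H) :=
  Submodule.span ℂ {a | ∃ x ∈ M₁, ∃ w, Red M₁ M₂ E false w ∧ a = x * w}

/-- the sum of `M₁` and the span of `M₁ W₂` -/
def Dsp (M₁ M₂ : VonNeumannAlgebra H) (E : BH H → BH H) : Submodule ℂ (BH H) :=
  Subalgebra.toSubmodule M₁.toStarSubalgebra.toSubalgebra ⊔ Rsp M₁ M₂ E

section afp
variable {M M₁ M₂ B : VonNeumannAlgebra H} {E : BH H → BH H} (h : IsAFP M M₁ M₂ B E)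

lemma Dsp_of_M {x : BH H} (hx : x ∈ M₁) : x ∈ Dsp M₁ M₂ E :=
  Submodule.mem_sup_left (show x ∈ Subalgebra.toSubmodule M₁.toStarSubalgebra.toSubalgebra from hx)

lemma Dsp_of_Rsp {x : BH H} (hx : x ∈ Rsp M₁ M₂ E) : x ∈ Dsp M₁ M₂ E :=
  Submodule.mem_sup_right hx

lemma Dsp_iff {a : BH H} : a ∈ Dsp M₁ M₂ E ↔ ∃ m ∈ M₁, ∃ r ∈ Rsp M₁ M₂ E, a = m + r := by
  constructor
  · intro ha
    obtain ⟨m, hm, r, hr, rfl⟩ := Submodule.mem_sup.1 ha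
    exact ⟨m, hm, r, hr, rfl⟩
  · rintro ⟨m, hm, r, hr, rfl⟩
    exact add_mem (Dsp_of_M hm) (Dsp_of_Rsp hr)

lemma Rsp_of {x w : BH H} (hx : x ∈ M₁) (hw : Red M₁ M₂ E false w) : x * w ∈ Rsp M₁ M₂ E :=
  Submodule.subset_span ⟨x, hx, w, hw, rfl⟩

lemma Rsp_of_red {w : BH H} (hw : Red M₁ M₂ E false w) : w ∈ Rsp M₁ M₂ E := by
  have := Rsp_of (one_mem M₁) hw
  rwa [one_mul] at this

lemma Dsp_of_red {i : Bool} {w : BH H} (hw : Red M₁ M₂ E i w) : w ∈ Dsp M₁ M₂ E := by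
  cases i with
  | false => exact Dsp_of_Rsp (Rsp_of_red hw)
  | true =>
    cases hw with
    | single _ _ hx hE => exact Dsp_of_M hx
    | cons _ x w hx hE hw => exact Dsp_of_Rsp (Rsp_of hx hw)

lemma Dsp_ind {T : Submodule ℂ (BH H)} (z : BH H) (h1 : ∀ m ∈ M₁, z * m ∈ T)
    (h2 : ∀ m ∈ M₁, ∀ w, Red M₁ M₂ E false w → z * (m * w) ∈ T) :
    ∀ d ∈ Dsp M₁ M₂ E, z * d ∈ T := by
  have h3 : Dsp M₁ M₂ E ≤ T.comap (LinearMap.mulLeft ℂ z) := by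
    refine sup_le ?_ ?_
    · intro m hm; exact h1 m hm
    · refine Submodule.span_le.2 ?_
      rintro _ ⟨x, hx, w, hw, rfl⟩
      exact h2 x hx w hw
  intro d hd
  exact h3 hd

lemma Rsp_ind {T : Submodule ℂ (BH H)} {f : BH H →ₗ[ℂ] BH H} 
    (h2 : ∀ m ∈ M₁, ∀ w, Red M₁ M₂ E false w → f (m * w) ∈ T) :
    ∀ d ∈ Rsp M₁ M₂ E, f d ∈ T := by
  have h3 : Rsp M₁ M₂ E ≤ T.comap f := by
    refine Submodule.span_le.2 ?_
    rintro _ ⟨x, hx, w, hw, rfl⟩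
    exact h2 x hx w hw
  intro d hd
  exact h3 hd

lemma Dsp_M1 {z d : BH H} (hz : z ∈ M₁) (hd : d ∈ Dsp M₁ M₂ E) : z * d ∈ Dsp M₁ M₂ E := by
  refine Dsp_ind z ?_ ?_ d hd
  · intro m hm; exact Dsp_of_M (mul_mem hz hm)
  · intro m hm w hw; rw [← mul_assoc]; exact Dsp_of_Rsp (Rsp_of (mul_mem hz hm) hw)

include h

lemma Dsp_M2_red {z w : BH H} (hz : z ∈ M₂) (hw : Red M₁ M₂ E false w) :
    z * w ∈ Dsp M₁ M₂ E := by
  have hz' : z ∈ Lt M₁ M₂ false := hz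
  cases hw with
  | single _ _ hx hE =>
    have h1 : z * w ∈ Lt M₁ M₂ false := mul_mem hz' hx
    have h2 : z * w = (z * w - E (z * w)) + E (z * w) := by simp
    rw [h2]
    exact add_mem (Dsp_of_red (red_circ h h1)) (Dsp_of_M (h.le₁ (afp_E h (afp_Lt h h1))))
  | cons _ x v hx hE hv =>
    have h1 : z * x ∈ Lt M₁ M₂ false := mul_mem hz' hx
    have h2 : z * (x * v) = (z * x - E (z * x)) * v + E (z * x) * v := by
      rw [← add_mul]; simp [mul_assoc]
    rw [h2]
    exact add_mem (Dsp_of_red (red_circ_mul h h1 hv))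
      (Dsp_of_red (red_B h (afp_E h (afp_Lt h h1)) hv))

lemma Dsp_M2 {z d : BH H} (hz : z ∈ M₂) (hd : d ∈ Dsp M₁ M₂ E) : z * d ∈ Dsp M₁ M₂ E := by
  have hz' : z ∈ Lt M₁ M₂ false := hz
  refine Dsp_ind z ?_ ?_ d hd
  · intro m hm
    have hm' : m ∈ Lt M₁ M₂ true := hm
    have h1 : z * m = (z - E z) * (m - E m) + z * E m + E z * (m - E m) := by noncomm_ring
    rw [h1]
    have hEm := afp_E h (afp_Lt h hm')
    have hEz := afp_E h (afp_Lt h hz')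
    refine add_mem (add_mem (Dsp_of_red (red_circ_mul h hz' (red_circ h hm'))) ?_) ?_
    · have h3 : z * E m ∈ Lt M₁ M₂ false := mul_mem hz' (afp_B h hEm)
      have h2 : z * E m = (z * E m - E (z * E m)) + E (z * E m) := by simp
      rw [h2]
      exact add_mem (Dsp_of_red (red_circ h h3)) (Dsp_of_M (h.le₁ (afp_E h (afp_Lt h h3))))
    · exact Dsp_of_M (mul_mem (h.le₁ hEz) (sub_mem hm (h.le₁ hEm)))
  · intro m hm w hw
    have hm' : m ∈ Lt M₁ M₂ true := hm
    have hEm := afp_E h (afp_Lt h hm')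
    have hEz := afp_E h (afp_Lt h hz')
    have h1 : z * (m * w) = (z - E z) * ((m - E m) * w) + E z * ((m - E m) * w) + z * (E m * w) := by
      noncomm_ring
    rw [h1]
    have h2 := red_circ_mul h hm' hw
    exact add_mem (add_mem (Dsp_of_red (red_circ_mul h hz' h2)) (Dsp_of_red (red_B h hEz h2)))
      (Dsp_M2_red h hz (red_B h hEm hw))

lemma adjoin_le {a : BH H}
    (ha : a ∈ StarAlgebra.adjoin ℂ ((M₁ : Set (BH H)) ∪ (M₂ : Set (BH H)))) :
    a ∈ Dsp M₁ M₂ E := by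
  have key : (∀ d ∈ Dsp M₁ M₂ E, a * d ∈ Dsp M₁ M₂ E) ∧
      (∀ d ∈ Dsp M₁ M₂ E, star a * d ∈ Dsp M₁ M₂ E) := by
    induction ha using StarAlgebra.adjoin_induction with
    | mem x hx =>
      rcases hx with hx | hx
      · exact ⟨fun d hd => Dsp_M1 hx hd, fun d hd => Dsp_M1 (star_mem (S := VonNeumannAlgebra H) hx) hd⟩
      · exact ⟨fun d hd => Dsp_M2 h hx hd, fun d hd => Dsp_M2 h (star_mem (S := VonNeumannAlgebra H) hx) hd⟩
    | algebraMap r =>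
      constructor
      · intro d hd
        rw [Algebra.algebraMap_eq_smul_one, smul_mul_assoc, one_mul]
        exact Submodule.smul_mem _ _ hd
      · intro d hd
        rw [Algebra.algebraMap_eq_smul_one, star_smul, star_one, smul_mul_assoc, one_mul]
        exact Submodule.smul_mem _ _ hd
    | add x y hx hy h1 h2 =>
      constructor
      · intro d hd; rw [add_mul]; exact add_mem (h1.1 d hd) (h2.1 d hd)
      · intro d hd; rw [star_add, add_mul]; exact add_mem (h1.2 d hd) (h2.2 d hd)
    | mul x y hx hy h1 h2 =>
      constructor
      · intro d hd; rw [mul_assoc]; exact h1.1 _ (h2.1 d hd)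
      · intro d hd; rw [star_mul, mul_assoc]; exact h2.2 _ (h1.2 d hd)
    | star x hx h1 =>
      refine ⟨h1.2, ?_⟩
      rw [star_star]; exact h1.1
  have := key.1 1 (Dsp_of_M (one_mem M₁))
  rwa [mul_one] at this

lemma adjoin_M {a : BH H}
    (ha : a ∈ StarAlgebra.adjoin ℂ ((M₁ : Set (BH H)) ∪ (M₂ : Set (BH H)))) : a ∈ M := by
  have : StarAlgebra.adjoin ℂ ((M₁ : Set (BH H)) ∪ (M₂ : Set (BH H))) ≤ M.toStarSubalgebra :=
    StarAlgebra.adjoin_le (Set.union_subset h.le₁M h.le₂M)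
  exact this ha

lemma comm_M {y : BH H}
    (hy : ∀ a ∈ StarAlgebra.adjoin ℂ ((M₁ : Set (BH H)) ∪ (M₂ : Set (BH H))), a * y = y * a) :
    y ∈ Set.centralizer (M : Set (BH H)) := by
  have h1 : y ∈ Set.centralizer ((M₁ : Set (BH H)) ∪ (M₂ : Set (BH H))) := by
    intro a ha; exact hy a (StarAlgebra.subset_adjoin ℂ _ ha)
  rw [← h.generated]
  intro m hm
  exact (hm y h1).symm

lemma Rsp_M {r : BH H} (hr : r ∈ Rsp M₁ M₂ E) : r ∈ M := by
  have : Rsp M₁ M₂ E ≤ Subalgebra.toSubmodule M.toStarSubalgebra.toSubalgebra := by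
    refine Submodule.span_le.2 ?_
    rintro _ ⟨x, hx, w, hw, rfl⟩
    exact mul_mem (S := VonNeumannAlgebra H) (h.le₁M hx) (red_mem h hw)
  exact this hr

lemma Rsp_left {m r : BH H} (hm : m ∈ M₁) (hr : r ∈ Rsp M₁ M₂ E) : m * r ∈ Rsp M₁ M₂ E := by
  refine Rsp_ind (f := LinearMap.mulLeft ℂ m) ?_ r hr
  intro x hx w hw
  rw [LinearMap.mulLeft_apply, ← mul_assoc]
  exact Rsp_of (mul_mem hm hx) hw

lemma Rsp_right {m r : BH H} (hm : m ∈ M₁) (hr : r ∈ Rsp M₁ M₂ E) : r * m ∈ Rsp M₁ M₂ E := by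
  refine Rsp_ind (f := LinearMap.mulRight ℂ m) ?_ r hr
  intro x hx w hw
  rw [LinearMap.mulRight_apply, mul_assoc]
  have h1 : Submodule.span ℂ {w | Red M₁ M₂ E false w} ≤
      (Rsp M₁ M₂ E).comap (LinearMap.mulLeft ℂ x) := by
    refine Submodule.span_le.2 ?_
    intro w hw
    exact Rsp_of hx hw
  exact h1 (red_right_false h hw hm)

lemma Rsp_E {r : BH H} (hr : r ∈ Rsp M₁ M₂ E) : E r = 0 := by
  refine Submodule.span_induction (p := fun r _ => E r = 0) ?_ ?_ ?_ ?_ hr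
  · rintro _ ⟨x, hx, w, hw, rfl⟩; exact red_E_left h hw hx
  · exact h.condExp.fixes 0 (zero_mem B)
  · intro a b ha hb h1 h2
    rw [h.condExp.map_add _ (Rsp_M h ha) _ (Rsp_M h hb), h1, h2, add_zero]
  · intro c a ha h1
    rw [h.condExp.map_smul _ _ (Rsp_M h ha), h1, smul_zero]
end afp

section setup
variable {M M₁ M₂ B : VonNeumannAlgebra H} {E : BH H → BH H} {sf : StandardForm M} {ξ : H}
  {P₁ PB PK : BH H} (h : Setup M M₁ M₂ B E sf ξ P₁ PB PK)
include h

lemma st_phi {x : BH H} (hx : x ∈ M) (h0 : E x = 0) : ⟪ξ, x ξ⟫_ℂ = 0 := by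
  rw [← h.phiE x hx, h0]; simp

lemma st_PB {a : BH H} (ha : a ∈ M) : PB (a ξ) = E a ξ := by
  have hE := afp_E h.afp ha
  have h1 : PB (a ξ - E a ξ) = 0 := by
    refine aux_proj_zero h.PBs h.PBr h.PBf ?_
    rintro _ ⟨b, hb, rfl⟩
    have h2 : ⟪b ξ, a ξ - E a ξ⟫_ℂ = ⟪ξ, (star b * (a - E a)) ξ⟫_ℂ := by
      rw [mul_apply_eq_comp, aux_adj']; simp
    rw [h2]
    have h3 : a - E a ∈ M := sub_mem ha (afp_BM h.afp hE)
    refine st_phi h (mul_mem (star_mem (afp_BM h.afp hb)) h3) ?_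
    rw [ce_left h.afp.condExp (star_mem hb) h3, ce_idem h.afp.condExp ha, mul_zero]
  have h2 : PB (E a ξ) = E a ξ := h.PBf _ (subset_closure ⟨E a, hE, rfl⟩)
  rw [map_sub, h2, sub_eq_zero] at h1
  exact h1

lemma st_P1_Rsp {r : BH H} (hr : r ∈ Rsp M₁ M₂ E) : P₁ (r ξ) = 0 := by
  refine aux_proj_zero h.P1s h.P1r h.P1f ?_
  rintro _ ⟨b, hb, rfl⟩
  rw [← aux_adj', ← mul_apply_eq_comp]
  have h1 := Rsp_left h.afp (star_mem hb) hr
  exact st_phi h (Rsp_M h.afp h1) (Rsp_E h.afp h1)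

lemma st_P1_M {m : BH H} (hm : m ∈ M₁) : P₁ (m ξ) = m ξ :=
  h.P1f _ (subset_closure ⟨m, hm, rfl⟩)

lemma st_sa {a m r : BH H} (ha : a ∈ M) (has : IsSelfAdjoint a) (hm : m ∈ M₁)
    (hr : r ∈ Rsp M₁ M₂ E) (hamr : a = m + r) : IsSelfAdjoint m := by
  have h1 : ∀ y ∈ M₁, ⟪y ξ, (m - star m) ξ⟫_ℂ = 0 := by
    intro y hy
    have h2 : ⟪y ξ, a ξ⟫_ℂ = ⟪y ξ, m ξ⟫_ℂ := by
      have h3 := Rsp_left h.afp (star_mem hy) hr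
      have h4 := st_phi h (Rsp_M h.afp h3) (Rsp_E h.afp h3)
      rw [mul_apply_eq_comp, aux_adj'] at h4
      rw [hamr]
      simp [inner_add_right, h4]
    have h5 : ⟪ξ, a (y ξ)⟫_ℂ = ⟪ξ, m (y ξ)⟫_ℂ := by
      have h3 := Rsp_right h.afp hy hr
      have h4 := st_phi h (Rsp_M h.afp h3) (Rsp_E h.afp h3)
      rw [mul_apply_eq_comp] at h4
      rw [hamr]
      simp [inner_add_right, h4]
    have h6 : ⟪y ξ, star m ξ⟫_ℂ = ⟪y ξ, a ξ⟫_ℂ := by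
      rw [aux_adj', ← inner_conj_symm, ← h5, inner_conj_symm, ← aux_sa has]
    simp [inner_sub_right, h6, h2]
  have h2 := h1 (m - star m) (sub_mem hm (star_mem hm))
  rw [inner_self_eq_zero] at h2
  have h3 := h.sep _ (h.afp.le₁M (sub_mem hm (star_mem hm))) h2
  rw [isSelfAdjoint_iff]
  exact (sub_eq_zero.1 h3).symm

lemma st_cyc (v : H)
    (hv : ∀ a ∈ StarAlgebra.adjoin ℂ ((M₁ : Set (BH H)) ∪ (M₂ : Set (BH H))), ⟪a ξ, v⟫_ℂ = 0) :
    v = 0 := by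
  set 𝒜 := StarAlgebra.adjoin ℂ ((M₁ : Set (BH H)) ∪ (M₂ : Set (BH H))) with h𝒜
  obtain ⟨q, hqN, hq0, hqfix, hqsym, hqnorm, hquniq⟩ :=
    aux_proj (Submodule.span ℂ {u | ∃ a ∈ 𝒜, a ξ = u})
  have hmem : ∀ w, w ∈ (Submodule.span ℂ {u | ∃ a ∈ 𝒜, a ξ = u})ᗮ ↔ ∀ a ∈ 𝒜, ⟪a ξ, w⟫_ℂ = 0 := by
    intro w
    rw [Submodule.mem_orthogonal]
    constructor
    · intro hw a ha; exact hw _ (Submodule.subset_span ⟨a, ha, rfl⟩)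
    · intro hw u hu
      refine Submodule.span_induction (p := fun u _ => ⟪u, w⟫_ℂ = 0) ?_ ?_ ?_ ?_ hu
      · rintro _ ⟨a, ha, rfl⟩; exact hw a ha
      · simp
      · intro x y _ _ hx hy; rw [inner_add_left, hx, hy, add_zero]
      · intro c x _ hx; rw [inner_smul_left, hx, mul_zero]
  have hinv : ∀ a ∈ 𝒜, ∀ w ∈ (Submodule.span ℂ {u | ∃ a ∈ 𝒜, a ξ = u})ᗮ,
      a w ∈ (Submodule.span ℂ {u | ∃ a ∈ 𝒜, a ξ = u})ᗮ := by
    intro a ha w hw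
    rw [hmem] at hw ⊢
    intro c hc
    rw [← aux_adj, ← mul_apply_eq_comp]
    exact hw _ (mul_mem (star_mem ha) hc)
  have hcomm : ∀ a ∈ 𝒜, a * q = q * a := by
    intro a ha
    ext u
    symm
    refine hquniq _ _ (hinv a ha _ (hqN u)) ?_
    intro w hw
    have h1 := hq0 u _ (hinv _ (star_mem ha) w hw)
    rw [aux_adj'] at h1
    rw [← h1]; simp
  have hqM := comm_M h.afp hcomm
  have hqξ : q ξ = 0 := by
    refine hquniq _ _ (zero_mem _) ?_
    intro w hw
    have := (hmem w).1 hw 1 (one_mem _)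
    simpa using this
  have hvq : q v = v := hqfix v ((hmem v).2 hv)
  apply h.cyc
  intro m hm
  rw [← hvq, ← hqsym]
  have h1 : m (q ξ) = q (m ξ) := congrArg (fun T : BH H => T ξ) (hqM m hm)
  rw [← h1, hqξ]; simp

lemma st_JP1 (ζ : H) : P₁ (sf.J ζ) = sf.J (P₁ ζ) := by
  refine aux_J_comm_sf M sf ξ h.hξ (StarAlgebra.adjoin ℂ ((M₁ : Set (BH H)) ∪ (M₂ : Set (BH H))))
    (fun a ha => adjoin_M h.afp ha) (fun y hy => comm_M h.afp hy) (st_cyc h) P₁ h.P1s ?_ ζ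
  intro a ha has
  obtain ⟨m, hm, r, hr, hamr⟩ := Dsp_iff.1 (adjoin_le h.afp ha)
  have hms := st_sa h (adjoin_M h.afp ha) has hm hr hamr
  have h1 : P₁ (a ξ) = m ξ := by
    rw [hamr, add_apply, map_add, st_P1_M h hm, st_P1_Rsp h hr, add_zero]
  rw [h1]
  exact subset_closure ⟨m, StarAlgebra.subset_adjoin ℂ _ (Or.inl hm), hms, rfl⟩

lemma st_JPB (ζ : H) : PB (sf.J ζ) = sf.J (PB ζ) := by
  refine aux_J_comm_sf M sf ξ h.hξ (StarAlgebra.adjoin ℂ ((M₁ : Set (BH H)) ∪ (M₂ : Set (BH H))))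
    (fun a ha => adjoin_M h.afp ha) (fun y hy => comm_M h.afp hy) (st_cyc h) PB h.PBs ?_ ζ
  intro a ha has
  have haM := adjoin_M h.afp ha
  rw [st_PB h haM]
  exact subset_closure ⟨E a, StarAlgebra.subset_adjoin ℂ _ (Or.inl (h.afp.le₁ (afp_E h.afp haM))),
    ce_sa h.afp.condExp haM has, rfl⟩
end setup

lemma aux_map_closure (x : BH H) {S S' : Set H} (h1 : ∀ s ∈ S, x s ∈ closure S') {v : H}
    (hv : v ∈ closure S) : x v ∈ closure S' :=
  closure_minimal (t := x ⁻¹' closure S') h1 (isClosed_closure.preimage x.continuous) hv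

lemma aux_inv_comm {P : BH H} (hP : IsSelfAdjoint P) {S : Set H} (hr : ∀ η, P η ∈ closure S)
    (hf : ∀ η ∈ closure S, P η = η) (x : BH H) (h1 : ∀ s ∈ S, x s ∈ closure S)
    (h2 : ∀ s ∈ S, star x s ∈ closure S) (v : H) : P (x v) = x (P v) := by
  have g1 : ∀ v, P (x (P v)) = x (P v) := fun v => hf _ (aux_map_closure x h1 (hr v))
  have g2 : ∀ v, P (star x (P v)) = star x (P v) := fun v => hf _ (aux_map_closure _ h2 (hr v))
  refine ext_inner_right ℂ fun w => ?_
  rw [aux_sa hP, ← aux_adj', ← g2, ← aux_sa hP, aux_adj', ← aux_sa hP, g1]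

lemma aux_span_closure (x : BH H) {S : Set H}
    (h : ∀ s ∈ S, x s ∈ closure (Submodule.span ℂ S : Set H)) :
    ∀ s ∈ (Submodule.span ℂ S : Set H), x s ∈ closure (Submodule.span ℂ S : Set H) := by
  have : Submodule.span ℂ S ≤ (Submodule.span ℂ S).topologicalClosure.comap (x : H →ₗ[ℂ] H) :=
    Submodule.span_le.2 h
  intro s hs
  exact this hs

lemma vn_dc (N : VonNeumannAlgebra H) {r : BH H}
    (h : ∀ b : BH H, (∀ c ∈ N, c * b = b * c) → b * r = r * b) : r ∈ N := by
  have h1 : r ∈ Set.centralizer (Set.centralizer (N : Set (BH H))) := fun b hb => h b hb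
  rw [VonNeumannAlgebra.centralizer_centralizer] at h1
  exact h1

lemma vn_sqrt (N : VonNeumannAlgebra H) {c : BH H} (hc : c ∈ N) (h0 : 0 ≤ c) :
    ∃ r ∈ N, IsSelfAdjoint r ∧ r * r = c := by
  obtain ⟨r, hs, hr, hcomm⟩ := aux_sqrt h0
  refine ⟨r, vn_dc N fun b hb => ?_, hs, hr⟩
  exact (hcomm b (hb c hc)).symm

section setup
variable {M M₁ M₂ B : VonNeumannAlgebra H} {E : BH H → BH H} {sf : StandardForm M} {ξ : H}
  {P₁ PB PK : BH H} (h : Setup M M₁ M₂ B E sf ξ P₁ PB PK)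
include h

lemma st_P1x {x : BH H} (hx : x ∈ M₁) (v : H) : P₁ (x v) = x (P₁ v) := by
  refine aux_inv_comm h.P1s h.P1r h.P1f x ?_ ?_ v
  · rintro _ ⟨m, hm, rfl⟩; exact subset_closure ⟨x * m, mul_mem hx hm, rfl⟩
  · rintro _ ⟨m, hm, rfl⟩; exact subset_closure ⟨star x * m, mul_mem (star_mem hx) hm, rfl⟩

lemma st_PBb {x : BH H} (hx : x ∈ B) (v : H) : PB (x v) = x (PB v) := by
  refine aux_inv_comm h.PBs h.PBr h.PBf x ?_ ?_ v
  · rintro _ ⟨m, hm, rfl⟩; exact subset_closure ⟨x * m, mul_mem hx hm, rfl⟩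
  · rintro _ ⟨m, hm, rfl⟩; exact subset_closure ⟨star x * m, mul_mem (star_mem hx) hm, rfl⟩

lemma st_PKb {x : BH H} (hx : x ∈ B) (v : H) : PK (x v) = x (PK v) := by
  refine aux_inv_comm h.PKs h.PKr h.PKf x ?_ ?_ v
  · refine aux_span_closure x ?_
    rintro _ ⟨w, hw, rfl⟩
    exact subset_closure (Submodule.subset_span ⟨x * w, red_B h.afp hx hw, rfl⟩)
  · refine aux_span_closure _ ?_
    rintro _ ⟨w, hw, rfl⟩
    exact subset_closure (Submodule.subset_span ⟨star x * w, red_B h.afp (star_mem hx) hw, rfl⟩)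

lemma st_Jxi : sf.J ξ = ξ := sf.J_fixes_cone ξ h.hξ

omit h in
lemma st_conj {m : BH H} (hm : m ∈ M) (x : BH H) (hx : x ∈ M) (v : H) :
    conjJ sf.J m (x v) = x (conjJ sf.J m v) := by
  have : conjJ sf.J m ∈ Set.centralizer (M : Set (BH H)) := by
    rw [sf.commutant_eq]; exact ⟨m, hm, rfl⟩
  exact (congrArg (fun T : BH H => T v) (this x hx)).symm

omit h in
lemma st_conj' {m : BH H} (hm : m ∈ M) : conjJ sf.J m ∈ Set.centralizer (M : Set (BH H)) := by
  rw [sf.commutant_eq]; exact ⟨m, hm, rfl⟩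

lemma st_PKJ {m : BH H} (hm : m ∈ M₁) (v : H) : PK (conjJ sf.J m v) = conjJ sf.J m (PK v) := by
  have key : ∀ m ∈ M₁, ∀ s ∈ (Submodule.span ℂ
      ((fun w : BH H => w ξ) '' {w | Red M₁ M₂ E false w}) : Set H), conjJ sf.J m s ∈
      closure (Submodule.span ℂ
      ((fun w : BH H => w ξ) '' {w | Red M₁ M₂ E false w}) : Set H) := by
    intro m hm
    refine aux_span_closure _ ?_
    rintro _ ⟨w, hw, rfl⟩
    dsimp only
    rw [st_conj (h.afp.le₁M hm) w (red_mem h.afp hw), aux_conjJ _ sf.J_involutive, st_Jxi h]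
    have h1 : sf.J (m ξ) ∈ closure {η : H | ∃ x ∈ M₁, x ξ = η} := by
      rw [← st_P1_M h hm, ← st_JP1 h]; exact h.P1r _
    refine aux_map_closure w ?_ h1
    rintro _ ⟨x, hx, rfl⟩
    have h2 := red_right_false h.afp hw hx
    have h3 : Submodule.span ℂ {w | Red M₁ M₂ E false w} ≤ (Submodule.span ℂ
      ((fun w : BH H => w ξ) '' {w | Red M₁ M₂ E false w})).comap
        (ContinuousLinearMap.apply ℂ H ξ : BH H →ₗ[ℂ] H) := by
      refine Submodule.span_le.2 ?_
      intro w hw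
      exact Submodule.subset_span ⟨w, hw, rfl⟩
    exact subset_closure (h3 h2)
  refine aux_inv_comm h.PKs h.PKr h.PKf _ (key m hm) ?_ v
  rw [aux_conjJ_star _ sf.J_involutive]
  exact key _ (star_mem hm)

lemma st_PKx {x : BH H} (hx : x ∈ M₁) (v : H) : PK (x (PK v)) = E x (PK v) := by
  have hx' : x ∈ Lt M₁ M₂ true := hx
  have hE := afp_E h.afp (afp_Lt h.afp hx')
  have h1 : PK ((x - E x) (PK v)) = 0 := by
    refine aux_proj_zero h.PKs h.PKr h.PKf ?_
    intro s hs
    refine Submodule.span_induction (p := fun s _ => ⟪s, (x - E x) (PK v)⟫_ℂ = 0) ?_ ?_ ?_ ?_ hs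
    · rintro _ ⟨w, hw, rfl⟩
      rw [← aux_adj, ← inner_conj_symm]
      rw [aux_ortho_closure (u := PK v) (v := star (x - E x) (w ξ)) _ (h.PKr v), map_zero]
      intro t ht
      refine Submodule.span_induction (p := fun t _ => ⟪t, star (x - E x) (w ξ)⟫_ℂ = 0) ?_ ?_ ?_ ?_ ht
      · rintro _ ⟨w', hw', rfl⟩
        dsimp only
        have hm := sub_mem hx (h.afp.le₁ hE)
        have h2 : Red M₁ M₂ E true (star (x - E x) * w) := by
          refine Red.cons _ _ _ (star_mem (s := Lt M₁ M₂ true) hm) ?_ hw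
          rw [ce_star h.afp.condExp (h.afp.le₁M hm), ce_idem h.afp.condExp (h.afp.le₁M hx), star_zero]
        have h3 := red_ortho h.afp hw' _ h2
        have h4 := st_phi h (mul_mem (star_mem (red_mem h.afp hw')) (red_mem h.afp h2)) h3
        rw [mul_apply_eq_comp, aux_adj', mul_apply_eq_comp] at h4
        exact h4
      · simp
      · intro a b _ _ ha hb; rw [inner_add_left, ha, hb, add_zero]
      · intro c a _ ha; rw [inner_smul_left, ha, mul_zero]
    · simp
    · intro a b _ _ ha hb; rw [inner_add_left, ha, hb, add_zero]
    · intro c a _ ha; rw [inner_smul_left, ha, mul_zero]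
  rw [sub_apply, map_sub, st_PKb h hE, h.PKf _ (h.PKr v), sub_eq_zero] at h1
  exact h1

lemma st_P1PK (v : H) : P₁ (PK v) = 0 := by
  have h1 : ∀ s ∈ (Submodule.span ℂ
      ((fun w : BH H => w ξ) '' {w | Red M₁ M₂ E false w}) : Set H), P₁ s = 0 := by
    have : Submodule.span ℂ ((fun w : BH H => w ξ) '' {w | Red M₁ M₂ E false w}) ≤
        LinearMap.ker (P₁ : H →ₗ[ℂ] H) := by
      refine Submodule.span_le.2 ?_
      rintro _ ⟨w, hw, rfl⟩
      exact st_P1_Rsp h (Rsp_of_red hw)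
    intro s hs; exact this hs
  exact closure_minimal (t := {u | P₁ u = 0}) h1
    (isClosed_eq P₁.continuous continuous_const) (h.PKr v)

lemma st_PBx {x : BH H} (hx : x ∈ M) (v : H) : PB (x (PB v)) = E x (PB v) := by
  refine closure_minimal (t := {u | PB (x u) = E x u}) ?_
    (isClosed_eq (by fun_prop) (by fun_prop)) (h.PBr v)
  rintro _ ⟨b, hb, rfl⟩
  change PB ((x * b) ξ) = (E x * b) ξ
  rw [st_PB h (mul_mem hx (afp_BM h.afp hb)), ce_right h.afp.condExp hb hx]

lemma st_P1PB (v : H) : P₁ (PB v) = PB v := by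
  refine h.P1f _ (closure_mono ?_ (h.PBr v))
  rintro _ ⟨b, hb, rfl⟩
  exact ⟨b, h.afp.le₁ hb, rfl⟩

lemma st_PBP1 (v : H) : PB (P₁ v) = PB v := by
  refine ext_inner_right ℂ fun w => ?_
  rw [aux_sa h.PBs, aux_sa h.P1s, st_P1PB h, ← aux_sa h.PBs]

lemma st_PBxi : PB ξ = ξ := h.PBf _ (subset_closure ⟨1, one_mem B, rfl⟩)
lemma st_P1xi : P₁ ξ = ξ := h.P1f _ (subset_closure ⟨1, one_mem M₁, rfl⟩)
lemma st_P1P1 (v : H) : P₁ (P₁ v) = P₁ v := h.P1f _ (h.P1r v)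

lemma st_ext1 {A A' : BH H} (hA : ∀ x ∈ M₁, A (x ξ) = A' (x ξ)) (v : H) :
    A (P₁ v) = A' (P₁ v) := by
  refine closure_minimal (t := {u | A u = A' u}) ?_
    (isClosed_eq (by fun_prop) (by fun_prop)) (h.P1r v)
  rintro _ ⟨b, hb, rfl⟩
  exact hA b hb

lemma st_ext {A A' : BH H} (hA : ∀ x ∈ M, A (x ξ) = A' (x ξ)) : A = A' := by
  have h1 : star A = star A' := by
    ext v
    rw [← sub_eq_zero]
    apply h.cyc
    intro m hm
    rw [inner_sub_right, aux_adj', aux_adj', hA m hm, sub_self]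
  exact star_injective h1

/-- for positive elements -/
lemma st_sqrt {x : BH H} (hx : x ∈ M) : ∃ r ∈ B, IsSelfAdjoint r ∧ r * r = E (star x * x) ∧
    ‖r ξ‖ = ‖x ξ‖ := by
  have h1 : star x * x ∈ M := mul_mem (star_mem hx) hx
  obtain ⟨r, hr, hrs, hrr⟩ := vn_sqrt B (afp_E h.afp h1)
    (h.afp.condExp.pos _ h1 (star_mul_self_nonneg x))
  refine ⟨r, hr, hrs, hrr, ?_⟩
  have h2 := h.phiE _ h1
  rw [← hrr, mul_apply_eq_comp, mul_apply_eq_comp, aux_adj', ← aux_sa hrs, aux_inner_self,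
    aux_inner_self] at h2
  have h3 : ‖r ξ‖ ^ 2 = ‖x ξ‖ ^ 2 := by exact_mod_cast h2
  exact (sq_eq_sq₀ (norm_nonneg _) (norm_nonneg _)).1 h3

omit h in
lemma st_norm_eq {x r : BH H} (hrs : IsSelfAdjoint r) (hrr : r * r = E (star x * x)) {k : H}
    (hk : ⟪k, (star x * x) k⟫_ℂ = ⟪k, E (star x * x) k⟫_ℂ) : ‖x k‖ = ‖r k‖ := by
  rw [← hrr, mul_apply_eq_comp, mul_apply_eq_comp, aux_adj', ← aux_sa hrs, aux_inner_self,
    aux_inner_self] at hk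
  have h3 : ‖x k‖ ^ 2 = ‖r k‖ ^ 2 := by exact_mod_cast hk
  exact (sq_eq_sq₀ (norm_nonneg _) (norm_nonneg _)).1 h3

lemma st_tot' {v : H} (hv : ∀ y ∈ Set.centralizer (M : Set (BH H)), ⟪y ξ, v⟫_ℂ = 0) : v = 0 := by
  have h1 : sf.J v = 0 := by
    apply h.cyc
    intro m hm
    have h2 := hv _ (st_conj' (sf := sf) hm)
    rw [aux_conjJ _ sf.J_involutive, st_Jxi h] at h2
    rw [← sf.J_involutive v, aux_antiinner] at h2
    rw [← inner_conj_symm, h2, map_zero]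
  rw [← sf.J_involutive v, h1, map_zero]
end setup

/-- the operators `x ξ ↦ x P_K y ξ` -/
def IsV (M₁ : VonNeumannAlgebra H) (ξ : H) (P₁ PK : BH H) (y A : BH H) : Prop :=
  (∀ x ∈ M₁, A (x ξ) = x (PK (y ξ))) ∧ ∀ v, A (P₁ v) = A v

section setup
variable {M M₁ M₂ B : VonNeumannAlgebra H} {E : BH H → BH H} {sf : StandardForm M} {ξ : H}
  {P₁ PB PK : BH H} (h : Setup M M₁ M₂ B E sf ξ P₁ PB PK)
include h

lemma V_ex {y : BH H} (hy : y ∈ Set.centralizer (M : Set (BH H))) : ∃ A, IsV M₁ ξ P₁ PK y A := by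
  let X := Subalgebra.toSubmodule M₁.toStarSubalgebra.toSubalgebra
  let e : X →ₗ[ℂ] H := (ContinuousLinearMap.apply ℂ H ξ : BH H →ₗ[ℂ] H).comp X.subtype
  let f : X →ₗ[ℂ] H := (ContinuousLinearMap.apply ℂ H (PK (y ξ)) : BH H →ₗ[ℂ] H).comp X.subtype
  have hb : ∀ x, ‖f x‖ ≤ ‖y‖ * ‖e x‖ := by
    rintro ⟨x, hx⟩
    change ‖x (PK (y ξ))‖ ≤ ‖y‖ * ‖x ξ‖
    have hx1 : x ∈ M₁ := hx
    obtain ⟨r, hr, hrs, hrr, hn⟩ := st_sqrt h (h.afp.le₁M hx1)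
    rw [st_norm_eq hrs hrr, ← hn]
    · rw [← st_PKb h hr]
      have h1 : r (y ξ) = y (r ξ) := congrArg (fun T : BH H => T ξ) (hy r (afp_BM h.afp hr))
      rw [h1]
      have h2 : ‖PK (y (r ξ))‖ ≤ ‖y (r ξ)‖ := by
        have h3 : ‖PK (y (r ξ))‖ ^ 2 ≤ ‖PK (y (r ξ))‖ * ‖y (r ξ)‖ := by
          have h4 : ⟪PK (y (r ξ)), y (r ξ)⟫_ℂ = ((‖PK (y (r ξ))‖ ^ 2 : ℝ) : ℂ) := by
            rw [← aux_inner_self, aux_sa h.PKs (y (r ξ)), aux_sa h.PKs (y (r ξ)),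
              h.PKf _ (h.PKr _)]
          have h5 := norm_inner_le_norm (𝕜 := ℂ) (PK (y (r ξ))) (y (r ξ))
          rw [h4, Complex.norm_real, Real.norm_of_nonneg (sq_nonneg _)] at h5
          exact h5
        by_contra hcon
        push Not at hcon
        nlinarith [norm_nonneg (PK (y (r ξ))), norm_nonneg (y (r ξ))]
      exact h2.trans (y.le_opNorm _)
    · rw [← h.PKf _ (h.PKr (y ξ)), aux_sa h.PKs, st_PKx h (mul_mem (star_mem hx1) hx1),
        ← h.PKf _ (h.PKr (y ξ)), aux_sa h.PKs, st_PKb h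
          (afp_E h.afp (h.afp.le₁M (mul_mem (star_mem hx1) hx1)))]
      simp only [h.PKf _ (h.PKr _)]
  obtain ⟨A, hA1, hA2⟩ := aux_extend e f ‖y‖ hb
  refine ⟨A, fun x hx => hA1 ⟨x, hx⟩, fun v => ?_⟩
  have h1 : A (v - P₁ v) = 0 := by
    apply hA2
    rintro ⟨x, hx⟩
    change ⟪x ξ, v - P₁ v⟫_ℂ = 0
    rw [← st_P1_M h hx, aux_sa h.P1s, map_sub, st_P1P1 h, sub_self, inner_zero_right]
  rw [map_sub, sub_eq_zero] at h1
  exact h1.symm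

variable {y A y' A' : BH H}

lemma V_x (hA : IsV M₁ ξ P₁ PK y A) {x : BH H} (hx : x ∈ M₁) (v : H) : A (x v) = x (A v) := by
  have h1 := st_ext1 h (A := A * x) (A' := x * A) (fun m hm => by
    change A ((x * m) ξ) = x (A (m ξ))
    rw [hA.1 _ (mul_mem hx hm), hA.1 _ hm]; rfl) v
  change A (x (P₁ v)) = x (A (P₁ v)) at h1
  rw [← st_P1x h hx, hA.2, hA.2] at h1
  exact h1

lemma V_PB (hA : IsV M₁ ξ P₁ PK y A) (v : H) : PK (A v) = A (PB v) := by
  have h1 := st_ext1 h (A := PK * A) (A' := A * PB) (fun m hm => by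
    change PK (A (m ξ)) = A (PB (m ξ))
    rw [hA.1 _ hm, st_PKx h hm, st_PB h (h.afp.le₁M hm),
      hA.1 _ (h.afp.le₁ (afp_E h.afp (h.afp.le₁M hm)))]) v
  change PK (A (P₁ v)) = A (PB (P₁ v)) at h1
  rw [hA.2, st_PBP1 h] at h1
  exact h1

lemma V_P1 (hA : IsV M₁ ξ P₁ PK y A) (v : H) : P₁ (A v) = 0 := by
  have h1 := st_ext1 h (A := P₁ * A) (A' := 0) (fun m hm => by
    change P₁ (A (m ξ)) = 0
    rw [hA.1 _ hm, st_P1x h hm, st_P1PK h, map_zero]) v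
  change P₁ (A (P₁ v)) = 0 at h1
  rwa [hA.2] at h1

lemma V_uniq (hA : IsV M₁ ξ P₁ PK y A) (hA' : IsV M₁ ξ P₁ PK y A') : A = A' := by
  ext v
  have h1 := st_ext1 h (A := A) (A' := A') (fun m hm => by rw [hA.1 _ hm, hA'.1 _ hm]) v
  rwa [hA.2, hA'.2] at h1

lemma V_J (hA : IsV M₁ ξ P₁ PK y A) {m : BH H} (hm : m ∈ M₁) :
    IsV M₁ ξ P₁ PK (conjJ sf.J m * y) (conjJ sf.J m * A) := by
  constructor
  · intro x hx
    change conjJ sf.J m (A (x ξ)) = x (PK (conjJ sf.J m (y ξ)))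
    rw [hA.1 x hx, st_conj (h.afp.le₁M hm) x (h.afp.le₁M hx), st_PKJ h hm]
  · intro v
    change conjJ sf.J m (A (P₁ v)) = conjJ sf.J m (A v)
    rw [hA.2]

lemma V_tot {v : H} (hV : ∀ y ∈ Set.centralizer (M : Set (BH H)), ∀ A, IsV M₁ ξ P₁ PK y A →
    ∀ ζ, ⟪A ζ, v⟫_ℂ = 0) (hP : P₁ v = 0) : v = 0 := by
  have h1 : ∀ x ∈ M₁, PK (star x v) = 0 := by
    intro x hx
    apply st_tot' h
    intro y hy
    obtain ⟨A, hA⟩ := V_ex h hy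
    have h2 := hV y hy A hA (x ξ)
    rw [hA.1 x hx, ← aux_adj', aux_sa h.PKs] at h2
    exact h2
  have h2 : ∀ x ∈ M₁, ∀ w, Red M₁ M₂ E false w → ⟪(x * w) ξ, v⟫_ℂ = 0 := by
    intro x hx w hw
    have h3 : PK (w ξ) = w ξ :=
      h.PKf _ (subset_closure (Submodule.subset_span ⟨w, hw, rfl⟩))
    rw [mul_apply_eq_comp, ← aux_adj', ← h3, aux_sa h.PKs, h1 x hx, inner_zero_right]
  apply st_cyc h
  intro a ha
  obtain ⟨m, hm, r, hr, rfl⟩ := Dsp_iff.1 (adjoin_le h.afp ha)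
  have h3 : ⟪r ξ, v⟫_ℂ = 0 := by
    refine Submodule.span_induction (p := fun r _ => ⟪r ξ, v⟫_ℂ = 0) ?_ ?_ ?_ ?_ hr
    · rintro _ ⟨x, hx, w, hw, rfl⟩; exact h2 x hx w hw
    · simp
    · intro a b _ _ ha hb; rw [add_apply, inner_add_left, ha, hb, add_zero]
    · intro c a _ ha; rw [smul_apply, inner_smul_left, ha, mul_zero]
  rw [add_apply, inner_add_left, h3, ← st_P1_M h hm, aux_sa h.P1s, hP, inner_zero_right, add_zero]

/-- elements of the relative basic construction commute with `V* V` -/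
lemma V_comm (hA : IsV M₁ ξ P₁ PK y A) (hA' : IsV M₁ ξ P₁ PK y' A') {T : BH H}
    (hT : T ∈ relBasicConstruction sf.J (B : Set (BH H)) P₁) :
    T * (star A * A') = (star A * A') * T := by
  set G := star A * A' with hG
  have hG' : ∀ v, G v = star A (A' v) := fun v => rfl
  have hGx : ∀ x ∈ M₁, ∀ v, G (x v) = x (G v) := by
    intro x hx v
    refine ext_inner_right ℂ fun w => ?_
    rw [hG', V_x h hA' hx, aux_adj, ← aux_adj', ← V_x h hA (star_mem hx), ← aux_adj, hG', aux_adj']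
  have hGPB : ∀ v, G (PB v) = PB (G v) := by
    intro v
    refine ext_inner_right ℂ fun w => ?_
    rw [hG', ← V_PB h hA', aux_adj, aux_sa h.PKs, V_PB h hA, ← aux_adj, hG', aux_sa h.PBs]
  have hGP : ∀ v, G (P₁ v) = G v := by
    intro v; rw [hG', hG', hA'.2]
  have hGξ : PB (G ξ) = G ξ := by rw [← hGPB, st_PBxi h]
  let X := Subalgebra.toSubmodule M.toStarSubalgebra.toSubalgebra
  let e : X →ₗ[ℂ] H := (ContinuousLinearMap.apply ℂ H ξ : BH H →ₗ[ℂ] H).comp X.subtype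
  let f : X →ₗ[ℂ] H := (ContinuousLinearMap.apply ℂ H (G ξ) : BH H →ₗ[ℂ] H).comp X.subtype
  have hb : ∀ x, ‖f x‖ ≤ ‖G‖ * ‖e x‖ := by
    rintro ⟨x, hx⟩
    change ‖x (G ξ)‖ ≤ ‖G‖ * ‖x ξ‖
    have hx1 : x ∈ M := hx
    obtain ⟨r, hr, hrs, hrr, hn⟩ := st_sqrt h hx1
    rw [st_norm_eq hrs hrr, ← hn, ← hGx r (h.afp.le₁ hr)]
    · exact G.le_opNorm _
    · rw [← hGξ, aux_sa h.PBs, st_PBx h (mul_mem (star_mem hx1) hx1),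
        aux_sa h.PBs, st_PBb h (afp_E h.afp (mul_mem (star_mem hx1) hx1)), hGξ, hGξ]
  obtain ⟨W, hW, -⟩ := aux_extend e f ‖G‖ hb
  replace hW : ∀ x ∈ M, W (x ξ) = x (G ξ) := fun x hx => hW ⟨x, hx⟩
  have hWM : W ∈ Set.centralizer (M : Set (BH H)) := by
    intro m hm
    apply st_ext h
    intro x hx
    change m (W (x ξ)) = W ((m * x) ξ)
    rw [hW x hx, hW _ (mul_mem hm hx)]; rfl
  have hWPB : W * PB = PB * W := by
    apply st_ext h
    intro x hx
    change W (PB (x ξ)) = PB (W (x ξ))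
    rw [st_PB h hx, hW _ (afp_BM h.afp (afp_E h.afp hx)), hW x hx, ← hGξ, st_PBx h hx]
  have hWP : ∀ v, W (P₁ v) = G v := by
    intro v
    rw [← hGP v]
    refine st_ext1 h (fun x hx => ?_) v
    rw [hW x (h.afp.le₁M hx), hGx x hx]
  rw [sf.commutant_eq] at hWM
  obtain ⟨b, hb, rfl⟩ := hWM
  have hbB : b ∈ B := by
    have h1 : b ξ = E b ξ := by
      rw [← st_PB h hb]
      have h2 := congrArg (fun T : BH H => sf.J (T ξ)) hWPB
      simp only [mul_apply_eq_comp] at h2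
      rw [st_PBxi h, aux_conjJ _ sf.J_involutive, st_Jxi h, ← st_JPB h, sf.J_involutive] at h2
      exact h2
    have h2 := h.sep (b - E b) (sub_mem hb (afp_BM h.afp (afp_E h.afp hb))) (by
      rw [sub_apply, h1, sub_self])
    rw [sub_eq_zero.1 h2]
    exact afp_E h.afp hb
  have hPW : ∀ v, P₁ (conjJ sf.J b v) = conjJ sf.J b (P₁ v) := by
    intro v
    rw [aux_conjJ _ sf.J_involutive, aux_conjJ _ sf.J_involutive, st_JP1 h,
      st_P1x h (h.afp.le₁ hbB), st_JP1 h]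
  obtain ⟨hT1, hT2⟩ := hT
  have hPT : ∀ v, P₁ (T v) = T v := by
    intro v; rw [← hT1]; exact st_P1P1 h _
  have hTP : ∀ v, T (P₁ v) = T v := by
    intro v; rw [← hT1]
    change P₁ (T (P₁ (P₁ v))) = P₁ (T (P₁ v))
    rw [st_P1P1 h]
  ext v
  change T (G v) = G (T v)
  have h1 := congrArg (fun T : BH H => T v) (hT2 b hbB)
  change P₁ (T (conjJ sf.J b (P₁ v))) = P₁ (conjJ sf.J b (T (P₁ v))) at h1
  rw [hPT, hWP, hTP, hPW, hPT] at h1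
  rw [h1, ← hWP, hPT]
end setup

/-- a total family of operators -/
structure Fam {ι : Type*} (V : ι → BH H) (P : BH H) : Prop where
  Ps : IsSelfAdjoint P
  PV : ∀ i v, P (V i v) = 0
  tot : ∀ v, (∀ i ζ, ⟪V i ζ, v⟫_ℂ = 0) → P v = 0 → v = 0

def Cm {ι : Type*} (V : ι → BH H) : Set (BH H) :=
  {T | ∀ i j, T * (star (V i) * V j) = (star (V i) * V j) * T}

def Rep {ι : Type*} (V : ι → BH H) (P T A : BH H) : Prop :=
  (∀ i v, A (V i v) = V i (T v)) ∧ ∀ v, A (P v) = 0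

section fam
variable {ι : Type*} {V : ι → BH H} {P T S A C : BH H}

lemma Cm_star (hT : T ∈ Cm V) : star T ∈ Cm V := by
  intro i j
  have := congrArg star (hT j i)
  simpa only [star_mul, star_star, mul_assoc] using this.symm

lemma Cm_mul (hT : T ∈ Cm V) (hS : S ∈ Cm V) : T * S ∈ Cm V := fun i j => by
  rw [mul_assoc, hS i j, ← mul_assoc, hT i j, mul_assoc]

lemma Cm_add (hT : T ∈ Cm V) (hS : S ∈ Cm V) : T + S ∈ Cm V := fun i j => by
  rw [add_mul, mul_add, hS i j, hT i j]

lemma Cm_smul (c : ℂ) (hT : T ∈ Cm V) : c • T ∈ Cm V := fun i j => by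
  rw [smul_mul_assoc, mul_smul_comm, hT i j]

lemma Cm_one : (1 : BH H) ∈ Cm V := fun i j => by rw [one_mul, mul_one]

lemma Cm_sub (hT : T ∈ Cm V) (hS : S ∈ Cm V) : T - S ∈ Cm V := fun i j => by
  rw [sub_mul, mul_sub, hS i j, hT i j]

lemma Cm_sqrt (hT : T ∈ Cm V) (h0 : 0 ≤ T) : ∃ R ∈ Cm V, IsSelfAdjoint R ∧ R * R = T := by
  obtain ⟨R, hs, hR, hc⟩ := aux_sqrt h0
  exact ⟨R, fun i j => hc _ (hT i j), hs, hR⟩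

lemma fam_ext (h : Fam V P) (h1 : ∀ i v, A (V i v) = C (V i v))
    (h2 : ∀ v, A (P v) = C (P v)) : A = C := by
  have h1 : star (A - C) = 0 := by
    ext v
    refine h.tot _ (fun i ζ => ?_) ?_
    · rw [aux_adj', sub_apply, h1, sub_self, inner_zero_left]
    · refine ext_inner_left ℂ fun w => ?_
      rw [← aux_sa h.Ps, aux_adj', sub_apply, h2, sub_self, inner_zero_left,
        inner_zero_right]
  rw [star_eq_zero, sub_eq_zero] at h1
  exact h1

lemma Rep_uniq (h : Fam V P) (hA : Rep V P T A) (hC : Rep V P T C) : A = C := by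
  have h1 : star (A - C) = 0 := by
    ext v
    refine h.tot _ (fun i ζ => ?_) ?_
    · rw [aux_adj', sub_apply, hA.1, hC.1, sub_self, inner_zero_left]
    · refine ext_inner_left ℂ fun w => ?_
      rw [← aux_sa h.Ps, aux_adj', sub_apply, hA.2, hC.2, sub_self, inner_zero_left,
        inner_zero_right]
  rw [star_eq_zero, sub_eq_zero] at h1
  exact h1

def Lam (V : ι → BH H) (T : BH H) : (ι →₀ H) →ₗ[ℂ] H :=
  Finsupp.lsum ℂ fun i => ((V i * T : BH H) : H →ₗ[ℂ] H)

lemma Lam_single (i : ι) (v : H) : Lam V T (Finsupp.single i v) = V i (T v) := by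
  simp [Lam]

lemma Lam_apply (f : ι →₀ H) : Lam V T f = f.sum fun i v => V i (T v) := by
  rw [Lam, Finsupp.lsum_apply]; rfl

lemma Lam_inner (hT : T ∈ Cm V) (f g : ι →₀ H) :
    ⟪Lam V T f, Lam V T g⟫_ℂ = ⟪Lam V 1 f, Lam V (star T * T) g⟫_ℂ := by
  have hl : ∀ (T S : BH H), ⟪Lam V T f, Lam V S g⟫_ℂ =
      ∑ i ∈ f.support, ∑ j ∈ g.support, ⟪V i (T (f i)), V j (S (g j))⟫_ℂ := by
    intro T S
    rw [Lam_apply, Lam_apply, Finsupp.sum, Finsupp.sum, sum_inner]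
    simp only [inner_sum]
  rw [hl, hl]
  refine Finset.sum_congr rfl fun i _ => Finset.sum_congr rfl fun j _ => ?_
  have h1 := congrArg (fun A : BH H => A (T (g j))) (Cm_star hT i j)
  change star T (star (V i) (V j (T (g j)))) = star (V i) (V j (star T (T (g j)))) at h1
  change _ = ⟪V i (f i), V j (star T (T (g j)))⟫_ℂ
  rw [← aux_adj', ← aux_adj', h1, aux_adj']

lemma Rep_ex (h : Fam V P) (hT : T ∈ Cm V) : ∃ A, Rep V P T A := by
  have hb : ∀ f, ‖Lam V T f‖ ≤ ‖T‖ * ‖Lam V 1 f‖ := by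
    intro f
    have hpos : 0 ≤ ((‖T‖ ^ 2 : ℝ) : ℂ) • (1 : BH H) - star T * T := by
      rw [aux_nonneg_iff]
      intro x
      rw [sub_apply, inner_sub_right, smul_apply, inner_smul_right]
      change 0 ≤ _ * ⟪x, x⟫_ℂ - ⟪x, star T (T x)⟫_ℂ
      rw [aux_adj', aux_inner_self, aux_inner_self]
      have h1 := T.le_opNorm x
      have h2 : ‖T x‖ ^ 2 ≤ ‖T‖ ^ 2 * ‖x‖ ^ 2 := by
        rw [← mul_pow]; exact pow_le_pow_left₀ (norm_nonneg _) h1 2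
      rw [← Complex.ofReal_mul, ← Complex.ofReal_sub]
      exact Complex.zero_le_real.2 (by linarith)
    obtain ⟨R, hR, hRs, hRR⟩ := Cm_sqrt
      (Cm_sub (Cm_smul _ Cm_one) (Cm_mul (Cm_star hT) hT)) hpos
    have h1 := Lam_inner hT f f
    have h2 := Lam_inner hR f f
    rw [hRs.star_eq, hRR] at h2
    have h3 : Lam V (((‖T‖ ^ 2 : ℝ) : ℂ) • (1 : BH H) - star T * T) f =
        ((‖T‖ ^ 2 : ℝ) : ℂ) • Lam V 1 f - Lam V (star T * T) f := by
      simp only [Lam_apply, Finsupp.sum, Finset.smul_sum, ← Finset.sum_sub_distrib]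
      refine Finset.sum_congr rfl fun i _ => ?_
      rw [sub_apply, map_sub, smul_apply, map_smul]
    rw [h3, inner_sub_right, ← h1, inner_smul_right, aux_inner_self, aux_inner_self,
      aux_inner_self, ← Complex.ofReal_mul, ← Complex.ofReal_sub] at h2
    have h4 := Complex.ofReal_injective h2
    refine le_of_sq_le_sq ?_ (by positivity)
    rw [mul_pow]
    nlinarith [sq_nonneg ‖Lam V R f‖]
  obtain ⟨A, h1, h2⟩ := aux_extend (Lam V 1) (Lam V T) ‖T‖ hb
  refine ⟨A, fun i v => ?_, fun v => h2 _ fun f => ?_⟩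
  · have := h1 (Finsupp.single i v)
    rwa [Lam_single, Lam_single] at this
  · rw [← aux_sa h.Ps, Lam_apply, Finsupp.sum, map_sum]
    simp [h.PV]

open Classical in
/-- the representation -/
def piR (V : ι → BH H) (P T : BH H) : BH H :=
  if h : ∃ A, Rep V P T A then h.choose else 0

lemma piR_eq (h : Fam V P) (hA : Rep V P T A) : piR V P T = A := by
  have hx : ∃ A, Rep V P T A := ⟨A, hA⟩
  rw [piR, dif_pos hx]
  exact Rep_uniq h hx.choose_spec hA

lemma piR_rep (h : Fam V P) (hT : T ∈ Cm V) : Rep V P T (piR V P T) := by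
  obtain ⟨A, hA⟩ := Rep_ex h hT
  rw [piR_eq h hA]; exact hA

lemma piR_add (h : Fam V P) (hT : T ∈ Cm V) (hS : S ∈ Cm V) :
    piR V P (T + S) = piR V P T + piR V P S := by
  have h1 := piR_rep h hT
  have h2 := piR_rep h hS
  refine piR_eq h ⟨fun i v => ?_, fun v => ?_⟩
  · rw [add_apply, h1.1, h2.1, add_apply, map_add]
  · rw [add_apply, h1.2, h2.2, add_zero]

lemma piR_smul (h : Fam V P) (c : ℂ) (hT : T ∈ Cm V) :
    piR V P (c • T) = c • piR V P T := by
  have h1 := piR_rep h hT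
  refine piR_eq h ⟨fun i v => ?_, fun v => ?_⟩
  · rw [smul_apply, h1.1, smul_apply, map_smul]
  · rw [smul_apply, h1.2, smul_zero]

lemma piR_sub (h : Fam V P) (hT : T ∈ Cm V) (hS : S ∈ Cm V) :
    piR V P (T - S) = piR V P T - piR V P S := by
  have h1 := piR_rep h hT
  have h2 := piR_rep h hS
  refine piR_eq h ⟨fun i v => ?_, fun v => ?_⟩
  · rw [sub_apply, h1.1, h2.1, sub_apply, map_sub]
  · rw [sub_apply, h1.2, h2.2, sub_zero]

lemma piR_mul (h : Fam V P) (hT : T ∈ Cm V) (hS : S ∈ Cm V) :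
    piR V P (T * S) = piR V P T * piR V P S := by
  have h1 := piR_rep h hT
  have h2 := piR_rep h hS
  refine piR_eq h ⟨fun i v => ?_, fun v => ?_⟩
  · rw [mul_apply_eq_comp, h2.1, h1.1]; rfl
  · rw [mul_apply_eq_comp, h2.2, map_zero]

lemma Rep_P (h : Fam V P) (hA : Rep V P T A) (v : H) : P (A v) = 0 := by
  have h1 : P * A = 0 := Rep_uniq h (T := 0) ⟨fun i v => by
    rw [mul_apply_eq_comp, hA.1, h.PV]; simp, fun v => by
    rw [mul_apply_eq_comp, hA.2, map_zero]⟩ ⟨fun i v => by simp, fun v => by simp⟩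
  exact congrArg (fun T : BH H => T v) h1

lemma piR_star (h : Fam V P) (hT : T ∈ Cm V) :
    piR V P (star T) = star (piR V P T) := by
  have h1 := piR_rep h hT
  refine piR_eq h ⟨fun i v => ?_, fun v => ?_⟩
  · rw [← sub_eq_zero]
    refine h.tot _ (fun j ζ => ?_) ?_
    · rw [inner_sub_right, aux_adj', h1.1]
      have h2 := congrArg (fun A : BH H => A v) (Cm_star hT j i)
      change star T (star (V j) (V i v)) = star (V j) (V i (star T v)) at h2
      rw [← aux_adj' (V j) ζ, ← h2, aux_adj' T, aux_adj' (V j), sub_self]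
    · rw [map_sub, h.PV, sub_zero]
      refine ext_inner_left ℂ fun w => ?_
      rw [← aux_sa h.Ps, aux_adj', h1.2, inner_zero_left, inner_zero_right]
  · refine ext_inner_left ℂ fun w => ?_
    rw [aux_adj', ← aux_sa h.Ps, Rep_P h h1, inner_zero_left, inner_zero_right]

lemma piR_pos (h : Fam V P) (hT : T ∈ Cm V) (h0 : 0 ≤ T) : 0 ≤ piR V P T := by
  obtain ⟨R, hR, hs, rfl⟩ := Cm_sqrt hT h0
  have h1 := piR_star h hR
  rw [hs.star_eq] at h1
  rw [piR_mul h hR hR]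
  nth_rewrite 1 [h1]
  exact star_mul_self_nonneg _

lemma piR_mono (h : Fam V P) (hT : T ∈ Cm V) (hS : S ∈ Cm V) (h0 : T ≤ S) :
    piR V P T ≤ piR V P S := by
  rw [← sub_nonneg, ← piR_sub h hS hT]
  exact piR_pos h (Cm_sub hS hT) (sub_nonneg.2 h0)

open Filter Topology in
lemma wk_lim (U : Ultrafilter (BH H)) (K : ℝ) (hU : ∀ᶠ T in (U : Filter (BH H)), ‖T‖ ≤ K) :
    ∃ y : BH H, ∀ ζ η, Tendsto (fun T : BH H => ⟪ζ, T η⟫_ℂ) U (𝓝 ⟪ζ, y η⟫_ℂ) := by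
  have hb : ∀ ζ η : H, ∀ᶠ T in (U : Filter (BH H)), ‖⟪ζ, T η⟫_ℂ‖ ≤ K * ‖ζ‖ * ‖η‖ := by
    intro ζ η
    filter_upwards [hU] with T hT
    calc ‖⟪ζ, T η⟫_ℂ‖ ≤ ‖ζ‖ * ‖T η‖ := norm_inner_le_norm _ _
      _ ≤ ‖ζ‖ * (‖T‖ * ‖η‖) := by gcongr; exact T.le_opNorm _
      _ ≤ ‖ζ‖ * (K * ‖η‖) := by gcongr
      _ = K * ‖ζ‖ * ‖η‖ := by ring
  have hex : ∀ ζ η : H, ∃ c : ℂ, ‖c‖ ≤ K * ‖ζ‖ * ‖η‖ ∧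
      Tendsto (fun T : BH H => ⟪ζ, T η⟫_ℂ) U (𝓝 c) := by
    intro ζ η
    have hc : IsCompact (Metric.closedBall (0 : ℂ) (K * ‖ζ‖ * ‖η‖)) := isCompact_closedBall _ _
    obtain ⟨c, hc1, hc2⟩ := hc.ultrafilter_le_nhds (U.map fun T : BH H => ⟪ζ, T η⟫_ℂ) (by
      rw [Ultrafilter.coe_map, le_principal_iff, mem_map]
      filter_upwards [hb ζ η] with T hT
      simpa using hT)
    exact ⟨c, by simpa using hc1, hc2⟩
  choose c hc1 hc2 using hex
  let F : H →L⋆[ℂ] H →L[ℂ] ℂ := LinearMap.mkContinuous₂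
    (LinearMap.mk₂'ₛₗ (starRingEnd ℂ) (RingHom.id ℂ) c
      (fun a b v => tendsto_nhds_unique (hc2 _ _) (by
        simpa only [inner_add_left] using (hc2 a v).add (hc2 b v)))
      (fun r a v => tendsto_nhds_unique (hc2 _ _) (by
        simpa only [inner_smul_left, smul_eq_mul] using (hc2 a v).const_mul _))
      (fun v a b => tendsto_nhds_unique (hc2 _ _) (by
        simpa only [map_add, inner_add_right] using (hc2 v a).add (hc2 v b)))
      (fun r v a => tendsto_nhds_unique (hc2 _ _) (by
        simpa only [map_smul, inner_smul_right, smul_eq_mul, RingHom.id_apply] using (hc2 v a).const_mul _))) K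
      (fun ζ η => hc1 ζ η)
  have hF : ∀ ζ η, F ζ η = c ζ η := fun ζ η => rfl
  refine ⟨star (InnerProductSpace.continuousLinearMapOfBilin F), fun ζ η => ?_⟩
  rw [aux_adj', InnerProductSpace.continuousLinearMapOfBilin_apply, hF]
  exact hc2 ζ η

lemma bdd_between {T₀ T x : BH H} (h1 : T₀ ≤ T) (h2 : T ≤ x) : ‖T‖ ≤ ‖x - T₀‖ + ‖T₀‖ := by
  have h3 : ‖T - T₀‖ ≤ ‖x - T₀‖ :=
    CStarAlgebra.norm_le_norm_of_nonneg_of_le (sub_nonneg.2 h1) (sub_le_sub_right h2 _)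
  calc ‖T‖ = ‖(T - T₀) + T₀‖ := by rw [sub_add_cancel]
    _ ≤ ‖T - T₀‖ + ‖T₀‖ := norm_add_le _ _
    _ ≤ _ := by gcongr

open Filter Topology in
lemma piR_normal (h : Fam V P) {N : Set (BH H)} (hN : N ⊆ Cm V) : IsNormalOn N (piR V P) := by
  intro S hS hne hdir x hx hlub
  obtain ⟨T₀, hT₀⟩ := hne
  haveI : Nonempty S := ⟨⟨T₀, hT₀⟩⟩
  haveI : IsDirectedOrder S := directedOn_iff_isDirectedOrder.1 hdir
  let F : Filter (BH H) := map (Subtype.val : S → BH H) atTop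
  haveI : F.NeBot := map_neBot
  let U : Ultrafilter (BH H) := Ultrafilter.of F
  have hU : (U : Filter (BH H)) ≤ F := Ultrafilter.of_le F
  have hUS : ∀ T₁ ∈ S, ∀ᶠ T in (U : Filter (BH H)), T ∈ S ∧ T₁ ≤ T := by
    intro T₁ hT₁
    apply hU
    change ∀ᶠ T in F, T ∈ S ∧ T₁ ≤ T
    rw [eventually_map]
    filter_upwards [eventually_ge_atTop (⟨T₁, hT₁⟩ : S)] with T hT
    exact ⟨T.2, hT⟩
  obtain ⟨y, hy⟩ := wk_lim U (‖x - T₀‖ + ‖T₀‖) (by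
    filter_upwards [hUS T₀ hT₀] with T hT
    exact bdd_between hT.2 (hlub.1 hT.1))
  have hyx : y = x := by
    apply le_antisymm
    · rw [← sub_nonneg, aux_nonneg_iff]
      intro ζ
      have h1 : Tendsto (fun T : BH H => ⟪ζ, (x - T) ζ⟫_ℂ) U (𝓝 ⟪ζ, (x - y) ζ⟫_ℂ) := by
        simpa only [sub_apply, inner_sub_right] using (hy ζ ζ).const_sub ⟪ζ, x ζ⟫_ℂ
      refine ge_of_tendsto h1 ?_
      filter_upwards [hUS T₀ hT₀] with T hT
      exact (aux_nonneg_iff _).1 (sub_nonneg.2 (hlub.1 hT.1)) ζ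
    · refine hlub.2 fun T₁ hT₁ => ?_
      rw [← sub_nonneg, aux_nonneg_iff]
      intro ζ
      have h1 : Tendsto (fun T : BH H => ⟪ζ, (T - T₁) ζ⟫_ℂ) U (𝓝 ⟪ζ, (y - T₁) ζ⟫_ℂ) := by
        simpa only [sub_apply, inner_sub_right] using (hy ζ ζ).sub_const ⟪ζ, T₁ ζ⟫_ℂ
      refine ge_of_tendsto h1 ?_
      filter_upwards [hUS T₁ hT₁] with T hT
      exact (aux_nonneg_iff _).1 (sub_nonneg.2 hT.2) ζ
  subst hyx
  have hle : ∀ T ∈ S, piR V P T ≤ piR V P y := fun T hT =>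
    piR_mono h (hN (hS hT)) (hN hx) (hlub.1 hT)
  obtain ⟨z, hz⟩ := wk_lim (U.map (piR V P)) (‖piR V P y - piR V P T₀‖ + ‖piR V P T₀‖) (by
    rw [Ultrafilter.coe_map, eventually_map]
    filter_upwards [hUS T₀ hT₀] with T hT
    exact bdd_between (piR_mono h (hN (hS hT₀)) (hN (hS hT.1)) hT.2) (hle T hT.1))
  replace hz : ∀ ζ η, Tendsto (fun T : BH H => ⟪ζ, piR V P T η⟫_ℂ) U (𝓝 ⟪ζ, z η⟫_ℂ) :=
    fun ζ η => (hz ζ η).comp tendsto_map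
  have hzy : piR V P y = z := by
    refine piR_eq h ⟨fun i v => ?_, fun v => ?_⟩
    · refine ext_inner_left ℂ fun w => ?_
      have h1 : Tendsto (fun T : BH H => ⟪w, V i (T v)⟫_ℂ) U (𝓝 ⟪w, V i (y v)⟫_ℂ) := by
        simpa only [aux_adj] using hy (star (V i) w) v
      refine tendsto_nhds_unique ((hz w (V i v)).congr' ?_) h1
      filter_upwards [hUS T₀ hT₀] with T hT
      rw [(piR_rep h (hN (hS hT.1))).1]
    · refine ext_inner_left ℂ fun w => ?_
      rw [inner_zero_right]
      refine tendsto_nhds_unique ((hz w (P v)).congr' ?_) tendsto_const_nhds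
      filter_upwards [hUS T₀ hT₀] with T hT
      rw [(piR_rep h (hN (hS hT.1))).2, inner_zero_right]
  refine ⟨?_, fun A hA => ?_⟩
  · rintro _ ⟨T, hT, rfl⟩
    exact hle T hT
  · rw [hzy, ← sub_nonneg, aux_nonneg_iff]
    intro ζ
    have h1 : Tendsto (fun T : BH H => ⟪ζ, (A - piR V P T) ζ⟫_ℂ) U (𝓝 ⟪ζ, (A - z) ζ⟫_ℂ) := by
      simpa only [sub_apply, inner_sub_right] using (hz ζ ζ).const_sub ⟪ζ, A ζ⟫_ℂ
    refine ge_of_tendsto h1 ?_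
    filter_upwards [hUS T₀ hT₀] with T hT
    exact (aux_nonneg_iff _).1 (sub_nonneg.2 (hA ⟨T, hT.1, rfl⟩)) ζ

end fam

/-- Let `M = M₁ *_B M₂` be an amalgamated free product of σ-finite von Neumann algebras.
There is a (nonunital) normal *-homomorphism `π : ⟨M₁, B⟩ → B(L²(M))` with range in the
basic construction `⟨M, M₁⟩`, such that `π(e_B) = P_K` and `π(x) = x e_{M₁}^⊥` for all
`x ∈ M₁` (an element `x ∈ M₁` is viewed inside `⟨M₁, B⟩ ⊆ B(L²(M₁))` as `x P₁`). -/
theorem exists_normal_rep_of_basicConstruction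
    {H : Type*} [NormedAddCommGroup H] [InnerProductSpace ℂ H] [CompleteSpace H]
    (M M₁ M₂ B : VonNeumannAlgebra H) (E : BH H → BH H)
    (hAFP : IsAFP M M₁ M₂ B E)
    (hσB : SigmaFinite (B : Set (BH H))) (hσ₁ : SigmaFinite (M₁ : Set (BH H)))
    (hσ₂ : SigmaFinite (M₂ : Set (BH H))) (hσM : SigmaFinite (M : Set (BH H)))
    (sf : StandardForm M)
    -- `ξ` implements a faithful normal state `φ` on `M` with `φ = φ ∘ E`
    (ξ : H) (hξcone : ξ ∈ sf.cone)
    (hξcyclic : Dense {η : H | ∃ x ∈ (M : Set (BH H)), x ξ = η})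
    (hξfaithful : ∀ x ∈ (M : Set (BH H)), 0 ≤ x → ⟪ξ, x ξ⟫_ℂ = 0 → x = 0)
    (hφE : ∀ x ∈ (M : Set (BH H)), ⟪ξ, (E x) ξ⟫_ℂ = ⟪ξ, x ξ⟫_ℂ)
    -- `P₁ = e_{M₁}`, the Jones projection of `M₁ ⊆ M`: the projection onto `L²(M₁)`
    (P₁ : BH H) (hP₁proj : IsProjection P₁)
    (hP₁range : ∀ η : H, P₁ η ∈ closure {η : H | ∃ x ∈ (M₁ : Set (BH H)), x ξ = η})
    (hP₁fix : ∀ η ∈ closure {η : H | ∃ x ∈ (M₁ : Set (BH H)), x ξ = η}, P₁ η = η)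
    -- `PB = e_B`, the Jones projection of `B ⊆ M₁`: the projection onto `L²(B)`
    (PB : BH H) (hPBproj : IsProjection PB)
    (hPBrange : ∀ η : H, PB η ∈ closure {η : H | ∃ b ∈ (B : Set (BH H)), b ξ = η})
    (hPBfix : ∀ η ∈ closure {η : H | ∃ b ∈ (B : Set (BH H)), b ξ = η}, PB η = η)
    -- `P_K`, the projection onto the closed span `K` of reduced words starting in `M₂ ⊖ B`
    (K : Set H)
    (hK : K = closure (Submodule.span ℂ
      ((fun w : BH H => w ξ) '' ReducedWordsStartM₂ M₁ M₂ E) : Set H))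
    (PK : BH H) (hPKproj : IsProjection PK)
    (hPKrange : ∀ η : H, PK η ∈ K) (hPKfix : ∀ η ∈ K, PK η = η) :
    ∃ π : BH H → BH H,
      (∀ T ∈ relBasicConstruction sf.J (B : Set (BH H)) P₁,
        π T ∈ basicConstruction sf.J (M₁ : Set (BH H))) ∧
      (∀ T ∈ relBasicConstruction sf.J (B : Set (BH H)) P₁,
        ∀ S ∈ relBasicConstruction sf.J (B : Set (BH H)) P₁, π (T + S) = π T + π S) ∧
      (∀ (c : ℂ), ∀ T ∈ relBasicConstruction sf.J (B : Set (BH H)) P₁,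
        π (c • T) = c • π T) ∧
      (∀ T ∈ relBasicConstruction sf.J (B : Set (BH H)) P₁,
        ∀ S ∈ relBasicConstruction sf.J (B : Set (BH H)) P₁, π (T * S) = π T * π S) ∧
      (∀ T ∈ relBasicConstruction sf.J (B : Set (BH H)) P₁,
        π (star T) = star (π T)) ∧
      IsNormalOn (relBasicConstruction sf.J (B : Set (BH H)) P₁) π ∧
      π PB = PK ∧
      (∀ x ∈ (M₁ : Set (BH H)), π (x * P₁) = x * (1 - P₁)) := by
  have h : Setup M M₁ M₂ B E sf ξ P₁ PB PK := by
    subst hK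
    rw [red_words] at hPKrange hPKfix
    refine ⟨hAFP, hξcone, ?_, ?_, hφE, hP₁proj.1, hP₁range, hP₁fix, hPBproj.1, hPBrange, hPBfix,
      hPKproj.1, hPKrange, hPKfix⟩
    · intro v hv
      have h1 : (fun η => ⟪η, v⟫_ℂ) = fun _ => 0 := by
        refine Continuous.ext_on hξcyclic (by fun_prop) continuous_const ?_
        rintro _ ⟨x, hx, rfl⟩
        exact hv x hx
      exact inner_self_eq_zero.1 (congrFun h1 v)
    · intro x hx h0
      have h1 := hξfaithful (star x * x) (mul_mem (star_mem hx) hx : star x * x ∈ M)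
        (star_mul_self_nonneg _) (by
          rw [mul_apply_eq_comp, h0, map_zero, inner_zero_right])
      exact CStarRing.star_mul_self_eq_zero_iff x |>.1 h1
  let ι := {y : BH H // y ∈ Set.centralizer (M : Set (BH H))}
  have hex : ∀ i : ι, ∃ A, IsV M₁ ξ P₁ PK i.1 A := fun i => V_ex h i.2
  choose V hV using hex
  have hF : Fam V P₁ := by
    refine ⟨h.P1s, fun i v => V_P1 h (hV i) v, fun v hv hP => V_tot h (fun y hy A hA ζ => ?_) hP⟩
    rw [V_uniq h hA (hV ⟨y, hy⟩)]
    exact hv _ ζ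
  have hC : relBasicConstruction sf.J (B : Set (BH H)) P₁ ⊆ Cm V :=
    fun T hT i j => V_comm h (hV i) (hV j) hT
  refine ⟨piR V P₁, ?_, fun T hT S hS => piR_add hF (hC hT) (hC hS),
    fun c T hT => piR_smul hF c (hC hT), fun T hT S hS => piR_mul hF (hC hT) (hC hS),
    fun T hT => piR_star hF (hC hT), piR_normal hF hC, ?_, ?_⟩
  · rintro T hT _ ⟨m, hm, rfl⟩
    have hr := piR_rep hF (hC hT)
    have hVJ : ∀ i, ∃ j, ∀ v, conjJ sf.J m (V i v) = V j v := by
      intro i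
      have hmem : conjJ sf.J m * i.1 ∈ Set.centralizer (M : Set (BH H)) := by
        refine Set.mul_mem_centralizer ?_ i.2
        rw [sf.commutant_eq]
        exact ⟨m, hAFP.le₁M hm, rfl⟩
      refine ⟨⟨_, hmem⟩, fun v => ?_⟩
      rw [← V_uniq h (V_J h (hV i) hm) (hV ⟨_, hmem⟩)]; rfl
    refine fam_ext hF (fun i v => ?_) (fun v => ?_)
    · obtain ⟨j, hj⟩ := hVJ i
      change conjJ sf.J m (piR V P₁ T (V i v)) = piR V P₁ T (conjJ sf.J m (V i v))
      rw [hr.1, hj, hj, hr.1]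
    · change conjJ sf.J m (piR V P₁ T (P₁ v)) = piR V P₁ T (conjJ sf.J m (P₁ v))
      have hPW : P₁ (conjJ sf.J m v) = conjJ sf.J m (P₁ v) := by
        rw [aux_conjJ _ sf.J_involutive, aux_conjJ _ sf.J_involutive, st_JP1 h,
          st_P1x h hm, st_JP1 h]
      rw [hr.2, map_zero, ← hPW, hr.2]
  · refine piR_eq hF ⟨fun i v => V_PB h (hV i) v, fun v => ?_⟩
    refine ext_inner_left ℂ fun w => ?_
    rw [← aux_sa h.PKs, ← aux_sa h.P1s, st_P1PK h, inner_zero_left, inner_zero_right]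
  · intro x hx
    refine piR_eq hF ⟨fun i v => ?_, fun v => ?_⟩
    · change x (V i v - P₁ (V i v)) = V i (x (P₁ v))
      rw [V_P1 h (hV i), sub_zero, V_x h (hV i) hx, (hV i).2]
    · change x (P₁ v - P₁ (P₁ v)) = 0
      rw [st_P1P1 h, sub_self, map_zero]

end AFP
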